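/- arXiv:2209.07767 — 6 statements merged into one kernel-verified Lean document; each statement's English description precedes it below -/
import Mathlib

section
/- Let ν > -1/2 and 0 ≤ |β| < α, and let p be the variance-gamma density with parameters (ν, α, β, 0). Then for every real k > k_* = max{-1, -2ν-1}, the k-th absolute moment satisfies ∫_ℝ |x|^k p(x) dx = (2^k (1 - β²/α²)^{ν+1/2} / (√π α^k Γ(ν+1/2))) · Γ(ν + (k+1)/2) Γ((k+1)/2) · ₂F₁((k+1)/2, ν + (k+1)/2; 1/2; β²/α²). -/
open MeasureTheory Real Filter

/-- The modified Bessel function of the second kind `K_ν(x)`. -/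
noncomputable def besselK (ν x : ℝ) : ℝ :=
  ∫ t in Set.Ioi (0 : ℝ), Real.exp (-x * Real.cosh t) * Real.cosh (ν * t)

/-- The variance-gamma density with parameters `(ν, α, β, 0)`. -/
noncomputable def vgDensity (ν α β x : ℝ) : ℝ :=
  (α ^ 2 - β ^ 2) ^ (ν + 1/2) / (Real.sqrt π * (2 * α) ^ ν * Real.Gamma (ν + 1/2)) *
    (Real.exp (β * x) * |x| ^ ν * besselK ν (α * |x|))

/-- The ascending factorial `(u)_j = u (u+1) ⋯ (u+j-1)`. -/
noncomputable def ascFactorial (u : ℝ) (j : ℕ) : ℝ := ∏ i ∈ Finset.range j, (u + i)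

/-- The Gaussian hypergeometric function `₂F₁(a, b; c; x)`. -/
noncomputable def hyp2F1 (a b c x : ℝ) : ℝ :=
  ∑' j : ℕ, ascFactorial a j * ascFactorial b j / ascFactorial c j * x ^ j / (Nat.factorial j)

lemma vg_beta {a b : ℝ} (ha : 0 < a) (hb : 0 < b) :
    ∫ x in Set.Ioo (0:ℝ) 1, x ^ (a - 1) * (1 - x) ^ (b - 1)
      = Real.Gamma a * Real.Gamma b / Real.Gamma (a + b) := by
  have h := ProbabilityTheory.lintegral_betaPDF_eq_one ha hb
  rw [ProbabilityTheory.lintegral_betaPDF, ← ENNReal.toReal_eq_one_iff,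
    ← integral_eq_lintegral_of_nonneg_ae] at h
  · simp_rw [mul_assoc, integral_const_mul] at h
    have hp := ProbabilityTheory.beta_pos ha hb
    rw [one_div, inv_mul_eq_div, div_eq_one_iff_eq hp.ne'] at h
    exact h
  · refine ae_restrict_of_forall_mem measurableSet_Ioo (fun x hx ↦ ?_)
    have h1 := hx.1
    have h2 : 0 < 1 - x := by linarith [hx.2]
    have hp := ProbabilityTheory.beta_pos ha hb
    simp only [Pi.zero_apply]
    positivity
  · exact Measurable.aestronglyMeasurable (by fun_prop)

/-- full line cosh integral -/
lemma vg_cosh_line {a b : ℝ} (ha : 0 < a) (hb : 0 < b) :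
    ∫ t : ℝ, Real.exp ((a - b) * t) * (Real.cosh t) ^ (-(a + b))
      = 2 ^ (a + b - 1) * (Real.Gamma a * Real.Gamma b / Real.Gamma (a + b)) := by
  set f : ℝ → ℝ := fun t => Real.exp t / (2 * Real.cosh t) with hf
  set f' : ℝ → ℝ := fun t => 2 * (Real.exp t / (2 * Real.cosh t)) * (Real.exp (-t) / (2 * Real.cosh t)) with hf'
  have h1 : ∀ t, 1 - f t = Real.exp (-t) / (2 * Real.cosh t) := by
    intro t
    have := Real.cosh_pos t
    simp only [hf]
    rw [eq_div_iff (by positivity), sub_mul, div_mul_cancel₀ _ (by positivity), Real.cosh_eq]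
    ring
  have hd : ∀ t, HasDerivAt f (f' t) t := by
    intro t
    have := Real.cosh_pos t
    have h : HasDerivAt f _ t := (Real.hasDerivAt_exp t).div ((Real.hasDerivAt_cosh t).const_mul 2) (by positivity)
    refine h.congr_deriv ?_
    simp only [hf']
    field_simp
    have e : Real.cosh t - Real.sinh t = Real.exp (-t) := Real.cosh_sub_sinh t
    rw [← e]; try ring
  have hpos : ∀ t, 0 < f' t := by
    intro t
    have := Real.cosh_pos t
    simp only [hf']; positivity
  have hmono : StrictMono f := strictMono_of_deriv_pos (fun t => by rw [(hd t).deriv]; exact hpos t)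
  have himg : f '' Set.univ = Set.Ioo 0 1 := by
    ext u
    simp only [Set.image_univ, Set.mem_range, Set.mem_Ioo]
    constructor
    · rintro ⟨t, rfl⟩
      have := Real.cosh_pos t
      refine ⟨by simp only [hf]; positivity, ?_⟩
      have : 0 < 1 - f t := by rw [h1]; positivity
      linarith
    · rintro ⟨h0, h1'⟩
      have hu : 0 < 1 - u := by linarith
      refine ⟨Real.log (u / (1 - u)) / 2, ?_⟩
      set t := Real.log (u / (1 - u)) / 2 with ht
      have e2 : Real.exp t * Real.exp t = u / (1 - u) := by
        rw [← Real.exp_add, ht, add_halves, Real.exp_log (by positivity)]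
      have : f t = (Real.exp t * Real.exp t) / (Real.exp t * Real.exp t + 1) := by
        simp only [hf]
        rw [Real.cosh_eq, Real.exp_neg]
        have := Real.exp_pos t
        field_simp
      rw [this, e2]
      field_simp
      ring
  have key := integral_image_eq_integral_abs_deriv_smul (s := Set.univ) MeasurableSet.univ
    (fun x _ => (hd x).hasDerivWithinAt) hmono.injective.injOn
    (fun x : ℝ => x ^ (a - 1) * (1 - x) ^ (b - 1))
  rw [himg, vg_beta ha hb, setIntegral_univ] at key
  rw [key, ← integral_const_mul]
  congr 1
  ext t
  have hc := Real.cosh_pos t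
  rw [h1, abs_of_pos (hpos t), smul_eq_mul]
  simp only [hf, hf']
  have q1 : 0 < Real.exp t / (2 * Real.cosh t) := by positivity
  have q2 : 0 < Real.exp (-t) / (2 * Real.cosh t) := by positivity
  rw [Real.rpow_sub_one q1.ne', Real.rpow_sub_one q2.ne']
  have : ∀ P Q x y : ℝ, x ≠ 0 → y ≠ 0 → 2 * x * y * (P / x * (Q / y)) = 2 * (P * Q) := by
    intros; field_simp
  rw [this _ _ _ _ q1.ne' q2.ne', Real.div_rpow (by positivity) (by positivity),
    Real.div_rpow (by positivity) (by positivity), ← Real.exp_mul, ← Real.exp_mul,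
    div_mul_div_comm, ← Real.exp_add, ← Real.rpow_add (by positivity),
    Real.mul_rpow (by positivity) hc.le, Real.rpow_neg hc.le, Real.rpow_sub_one (by norm_num)]
  have e : t * a + -t * b = (a - b) * t := by ring
  rw [e]
  have : (0:ℝ) < 2 ^ (a + b) := by positivity
  have : (0:ℝ) < Real.cosh t ^ (a + b) := by positivity
  field_simp

lemma vg_cosh_half {a b : ℝ} (ha : 0 < a) (hb : 0 < b) :
    ∫ t in Set.Ioi (0:ℝ), Real.cosh ((b - a) * t) * (Real.cosh t) ^ (-(a + b))
      = 2 ^ (a + b - 2) * (Real.Gamma a * Real.Gamma b / Real.Gamma (a + b)) := by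
  have h1 := vg_cosh_line ha hb
  have h2 := vg_cosh_line hb ha
  have ga := Real.Gamma_pos_of_pos ha
  have gb := Real.Gamma_pos_of_pos hb
  have gab := Real.Gamma_pos_of_pos (add_pos ha hb)
  have i1 : Integrable (fun t : ℝ => Real.exp ((a - b) * t) * (Real.cosh t) ^ (-(a + b))) :=
    .of_integral_ne_zero (by rw [h1]; positivity)
  rw [add_comm b a, mul_comm (Real.Gamma b)] at h2
  have i2 : Integrable (fun t : ℝ => Real.exp ((b - a) * t) * (Real.cosh t) ^ (-(a + b))) :=
    .of_integral_ne_zero (by rw [h2]; positivity)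
  have h3 := integral_add i1 i2
  rw [h1, h2] at h3
  have h4 := integral_comp_abs (f := fun t : ℝ => Real.cosh ((b - a) * t) * (Real.cosh t) ^ (-(a + b)))
  have h5 : ∀ t : ℝ, Real.exp ((a - b) * t) * (Real.cosh t) ^ (-(a + b)) +
      Real.exp ((b - a) * t) * (Real.cosh t) ^ (-(a + b)) =
      2 * (Real.cosh ((b - a) * |t|) * (Real.cosh |t|) ^ (-(a + b))) := by
    intro t
    have : Real.cosh ((b - a) * |t|) = Real.cosh ((b - a) * t) := by
      rcases abs_choice t with h | h <;> rw [h]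
      rw [mul_neg, Real.cosh_neg]
    rw [this, Real.cosh_abs, Real.cosh_eq ((b - a) * t)]
    have e : -((b - a) * t) = (a - b) * t := by ring
    rw [e]; ring
  simp_rw [h5] at h3
  rw [integral_const_mul, h4] at h3
  have h6 : (2:ℝ) ^ (a + b - 1) = 2 * 2 ^ (a + b - 2) := by
    rw [show a + b - 1 = (a + b - 2) + 1 by ring, Real.rpow_add_one (by norm_num)]; ring
  rw [h6] at h3
  linarith

lemma vg_mellin {a b c : ℝ} (ha : 0 < a) (hb : 0 < b) (hc : 0 < c) :
    ∫ x in Set.Ioi (0:ℝ), x ^ (a + b - 1) * besselK (b - a) (c * x)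
      = c ^ (-(a + b)) * 2 ^ (a + b - 2) * (Real.Gamma a * Real.Gamma b) := by
  have ga := Real.Gamma_pos_of_pos ha
  have gb := Real.Gamma_pos_of_pos hb
  have hab := add_pos ha hb
  have gab := Real.Gamma_pos_of_pos hab
  set F : ℝ → ℝ → ℝ := fun x t => x ^ (a + b - 1) *
    (Real.exp (-(c * x) * Real.cosh t) * Real.cosh ((b - a) * t)) with hF
  have hin : ∀ t, ∫ x in Set.Ioi (0:ℝ), F x t =
      c ^ (-(a + b)) * Real.Gamma (a + b) * (Real.cosh ((b - a) * t) * (Real.cosh t) ^ (-(a + b))) := by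
    intro t
    have hct := Real.cosh_pos t
    have := Real.integral_rpow_mul_exp_neg_mul_Ioi hab (mul_pos hc hct)
    have e : ∀ x, F x t = x ^ (a + b - 1) * Real.exp (-(c * Real.cosh t * x)) *
        Real.cosh ((b - a) * t) := by
      intro x
      simp only [hF]
      rw [show -(c * x) * Real.cosh t = -(c * Real.cosh t * x) by ring]; ring
    simp_rw [e]
    rw [integral_mul_const, this, one_div, ← Real.rpow_neg_one, ← Real.rpow_mul (by positivity),
      Real.mul_rpow hc.le hct.le]
    rw [show -1 * (a + b) = -(a + b) by ring]
    ring
  have hnn : ∀ t, ∀ x ∈ Set.Ioi (0:ℝ), ‖F x t‖ = F x t := by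
    intro t x hx
    have hx' : 0 < x := hx
    have := Real.cosh_pos ((b - a) * t)
    rw [Real.norm_of_nonneg]
    simp only [hF]; positivity
  have hI : Integrable (Function.uncurry F)
      ((volume.restrict (Set.Ioi (0:ℝ))).prod (volume.restrict (Set.Ioi (0:ℝ)))) := by
    rw [integrable_prod_iff']
    · refine ⟨Eventually.of_forall fun t => ?_, ?_⟩
      · refine .of_integral_ne_zero ?_
        have := hin t
        simp only [Function.uncurry]
        rw [this]
        have := Real.cosh_pos t
        have := Real.cosh_pos ((b - a) * t)
        positivity
      · have e : ∀ t, ∫ x in Set.Ioi (0:ℝ), ‖F x t‖ = c ^ (-(a + b)) * Real.Gamma (a + b) *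
            (Real.cosh ((b - a) * t) * (Real.cosh t) ^ (-(a + b))) := by
          intro t
          rw [← hin t]
          exact setIntegral_congr_fun measurableSet_Ioi (hnn t)
        simp only [Function.uncurry]
        simp_rw [e]
        refine Integrable.const_mul (.of_integral_ne_zero ?_) _
        rw [vg_cosh_half ha hb]
        positivity
    · refine Measurable.aestronglyMeasurable ?_
      simp only [hF, Function.uncurry_def]
      have := Real.continuous_cosh.measurable
      fun_prop
  have hswap := integral_integral_swap hI
  simp_rw [hin] at hswap
  rw [integral_const_mul, vg_cosh_half ha hb] at hswap
  have hl : ∀ x, ∫ t in Set.Ioi (0:ℝ), F x t = x ^ (a + b - 1) * besselK (b - a) (c * x) := by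
    intro x
    simp only [hF]
    rw [integral_const_mul, besselK]
  simp_rw [hl] at hswap
  rw [hswap]
  field_simp

lemma vg_asc_Gamma {u : ℝ} (hu : 0 < u) (j : ℕ) :
    Real.Gamma (u + j) = ascFactorial u j * Real.Gamma u := by
  induction j with
  | zero => simp [ascFactorial]
  | succ n ih =>
    have : ascFactorial u (n + 1) = ascFactorial u n * (u + n) := by
      simp [ascFactorial, Finset.prod_range_succ]
    rw [this, Nat.cast_succ, ← add_assoc, Real.Gamma_add_one (by positivity), ih]
    ring

lemma vg_asc_pos {u : ℝ} (hu : 0 < u) (j : ℕ) : 0 < ascFactorial u j :=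
  Finset.prod_pos fun i _ => by positivity

lemma vg_asc_succ (u : ℝ) (n : ℕ) : ascFactorial u (n + 1) = ascFactorial u n * (u + n) := by
  simp [ascFactorial, Finset.prod_range_succ]

lemma vg_asc_half (j : ℕ) :
    ascFactorial (1/2) j * (Nat.factorial j : ℝ) * 4 ^ j = (Nat.factorial (2 * j) : ℝ) := by
  induction j with
  | zero => simp [ascFactorial]
  | succ n ih =>
    rw [vg_asc_succ, show 2 * (n + 1) = (2 * n + 1) + 1 by ring, Nat.factorial_succ,
      Nat.factorial_succ, Nat.factorial_succ]
    push_cast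
    rw [← ih]
    ring

lemma vg_summable {a b z : ℝ} (ha : 0 < a) (hb : 0 < b) (hz0 : 0 ≤ z) (hz : z < 1) :
    Summable (fun j : ℕ => ascFactorial a j * ascFactorial b j / ascFactorial (1/2) j * z ^ j /
      (Nat.factorial j)) := by
  obtain ⟨r, hr, hr1⟩ := exists_between hz
  refine summable_of_ratio_norm_eventually_le hr1 ?_
  have ht : Tendsto (fun n : ℕ => (a + n) * (b + n) / ((1/2 + n) * (1 + n)) * z) atTop (nhds z) := by
    have h1 : ∀ p q : ℝ, 0 < q → Tendsto (fun n : ℕ => (p + n) / (q + n)) atTop (nhds 1) := by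
      intro p q hq
      have h := tendsto_const_nhds (x := (1:ℝ)) |>.add
        ((tendsto_const_nhds (x := p - q)).div_atTop
          (tendsto_atTop_add_const_left _ q tendsto_natCast_atTop_atTop (α := ℕ)))
      rw [add_zero] at h
      refine h.congr fun n => ?_
      have : 0 < q + n := by positivity
      field_simp
      ring
    have h := ((h1 a (1/2) (by norm_num)).mul (h1 b 1 (by norm_num))).mul_const z
    rw [one_mul, one_mul] at h
    refine h.congr fun n => ?_
    rw [div_mul_div_comm]
  filter_upwards [ht.eventually_le_const hr] with n hn
  have p1 := vg_asc_pos ha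
  have p2 := vg_asc_pos hb
  have p3 := vg_asc_pos (u := 1/2) (by norm_num)
  have nn : ∀ j : ℕ, 0 ≤ ascFactorial a j * ascFactorial b j / ascFactorial (1/2) j * z ^ j /
      (Nat.factorial j) := by
    intro j
    have := p1 j; have := p2 j; have := p3 j
    positivity
  rw [Real.norm_of_nonneg (nn _), Real.norm_of_nonneg (nn _)]
  refine le_trans (le_of_eq ?_) (mul_le_mul_of_nonneg_right hn (nn n))
  rw [vg_asc_succ, vg_asc_succ, vg_asc_succ, Nat.factorial_succ]
  have := p3 n
  push_cast
  field_simp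
  ring

lemma besselK_nonneg (ν x : ℝ) : 0 ≤ besselK ν x := by
  refine integral_nonneg fun t => ?_
  have := Real.cosh_pos (ν * t)
  simp only [Pi.zero_apply]
  positivity

lemma vg_half {a b c β : ℝ} (ha : 0 < a) (hb : 0 < b) (hc : 0 < c) (hβ : |β| < c) :
    ∫ x in Set.Ioi (0:ℝ), Real.cosh (β * x) * (x ^ (a + b - 1) * besselK (b - a) (c * x))
      = c ^ (-(a + b)) * 2 ^ (a + b - 2) * (Real.Gamma a * Real.Gamma b) *
        hyp2F1 a b (1/2) (β ^ 2 / c ^ 2) := by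
  have ga := Real.Gamma_pos_of_pos ha
  have gb := Real.Gamma_pos_of_pos hb
  have hz0 : 0 ≤ β ^ 2 / c ^ 2 := by positivity
  have hz : β ^ 2 / c ^ 2 < 1 := by
    rw [div_lt_one (by positivity)]
    exact sq_lt_sq' (by linarith [neg_abs_le β]) (by linarith [le_abs_self β])
  set C := c ^ (-(a + b)) * 2 ^ (a + b - 2) * (Real.Gamma a * Real.Gamma b) with hC
  set T : ℕ → ℝ := fun j => ascFactorial a j * ascFactorial b j / ascFactorial (1/2) j *
    (β ^ 2 / c ^ 2) ^ j / (Nat.factorial j) with hT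
  set F : ℕ → ℝ → ℝ := fun j x => (β * x) ^ (2 * j) / (Nat.factorial (2 * j) : ℝ) *
    (x ^ (a + b - 1) * besselK (b - a) (c * x)) with hF
  have e : ∀ j : ℕ, ∀ x ∈ Set.Ioi (0:ℝ), F j x = β ^ (2 * j) / (Nat.factorial (2 * j) : ℝ) *
      (x ^ ((a + j) + (b + j) - 1) * besselK ((b + j) - (a + j)) (c * x)) := by
    intro j x hx
    have hx' : 0 < x := hx
    simp only [hF]
    rw [show (a + j) + (b + j) - 1 = (a + b - 1) + ((2 * j : ℕ) : ℝ) by push_cast; ring,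
      Real.rpow_add hx', Real.rpow_natCast, mul_pow,
      show (b + j) - (a + j) = b - a by ring]
    ring
  have hm : ∀ j : ℕ, ∫ x in Set.Ioi (0:ℝ),
      (x ^ ((a + j) + (b + j) - 1) * besselK ((b + j) - (a + j)) (c * x)) = _ :=
    fun j => vg_mellin (a := a + j) (b := b + j) (by positivity) (by positivity) hc
  have hFint : ∀ j, IntegrableOn (F j) (Set.Ioi 0) := by
    intro j
    refine (integrableOn_congr_fun (e j) measurableSet_Ioi).mpr ?_
    refine Integrable.const_mul (.of_integral_ne_zero ?_) _
    rw [hm j]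
    have := Real.Gamma_pos_of_pos (s := a + j) (by positivity)
    have := Real.Gamma_pos_of_pos (s := b + j) (by positivity)
    positivity
  have hval : ∀ j, ∫ x in Set.Ioi (0:ℝ), F j x = C * T j := by
    intro j
    rw [setIntegral_congr_fun measurableSet_Ioi (e j), integral_const_mul, hm j,
      vg_asc_Gamma ha, vg_asc_Gamma hb, ← vg_asc_half j]
    simp only [hC, hT]
    have p3 := vg_asc_pos (u := 1/2) (by norm_num) j
    rw [show -(a + j + (b + j)) = -(a + b) - ((2 * j : ℕ) : ℝ) by push_cast; ring,
      show a + j + (b + j) - 2 = (a + b - 2) + ((2 * j : ℕ) : ℝ) by push_cast; ring,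
      Real.rpow_sub hc, Real.rpow_add (by norm_num), Real.rpow_natCast, Real.rpow_natCast,
      pow_mul (2:ℝ), pow_mul c, pow_mul β, div_pow]
    norm_num
    field_simp
  have hnorm : ∀ j, ∫ x in Set.Ioi (0:ℝ), ‖F j x‖ = C * T j := by
    intro j
    rw [← hval]
    refine setIntegral_congr_fun measurableSet_Ioi fun x hx => ?_
    have hx' : 0 < x := hx
    rw [Real.norm_of_nonneg]
    simp only [hF]
    have := besselK_nonneg (b - a) (c * x)
    rw [pow_mul]
    positivity
  have hs : HasSum _ _ := hasSum_integral_of_summable_integral_norm (F := F) (μ := volume.restrict (Set.Ioi 0)) hFint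
    (by simp_rw [hnorm]; exact (vg_summable ha hb hz0 hz).mul_left C)
  simp_rw [hval] at hs
  have h2 := hs.tsum_eq
  rw [tsum_mul_left] at h2
  rw [hyp2F1, h2]
  refine setIntegral_congr_fun measurableSet_Ioi fun x _ => ?_
  simp only [hF]
  rw [tsum_mul_right, ← Real.cosh_eq_tsum]

lemma vg_line {a b c β : ℝ} (ha : 0 < a) (hb : 0 < b) (hc : 0 < c) (hβ : |β| < c) :
    ∫ x : ℝ, Real.exp (β * x) * (|x| ^ (a + b - 1) * besselK (b - a) (c * |x|))
      = c ^ (-(a + b)) * 2 ^ (a + b - 1) * (Real.Gamma a * Real.Gamma b) *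
        hyp2F1 a b (1/2) (β ^ 2 / c ^ 2) := by
  have ga := Real.Gamma_pos_of_pos ha
  have gb := Real.Gamma_pos_of_pos hb
  have hz0 : 0 ≤ β ^ 2 / c ^ 2 := by positivity
  have hz : β ^ 2 / c ^ 2 < 1 := by
    rw [div_lt_one (by positivity)]
    exact sq_lt_sq' (by linarith [neg_abs_le β]) (by linarith [le_abs_self β])
  have hpos : 0 < hyp2F1 a b (1/2) (β ^ 2 / c ^ 2) := by
    refine (vg_summable ha hb hz0 hz).tsum_pos (fun j => ?_) 0 ?_
    · have := vg_asc_pos ha j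
      have := vg_asc_pos hb j
      have := vg_asc_pos (u := 1/2) (by norm_num) j
      positivity
    · simp [ascFactorial]
  set G : ℝ → ℝ := fun x => Real.cosh (β * x) * (|x| ^ (a + b - 1) * besselK (b - a) (c * |x|)) with hG
  set E : ℝ → ℝ := fun x => Real.exp (β * x) * (|x| ^ (a + b - 1) * besselK (b - a) (c * |x|)) with hE
  have hGi : ∫ x, G x = c ^ (-(a + b)) * 2 ^ (a + b - 1) * (Real.Gamma a * Real.Gamma b) *
        hyp2F1 a b (1/2) (β ^ 2 / c ^ 2) := by
    have h := integral_comp_abs (f := fun x : ℝ =>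
      Real.cosh (β * x) * (x ^ (a + b - 1) * besselK (b - a) (c * x)))
    rw [vg_half ha hb hc hβ] at h
    have h6 : (2:ℝ) ^ (a + b - 1) = 2 * 2 ^ (a + b - 2) := by
      rw [show a + b - 1 = (a + b - 2) + 1 by ring, Real.rpow_add_one (by norm_num)]; ring
    rw [h6]
    rw [show ∀ A B D H : ℝ, A * (2 * B) * D * H = 2 * (A * B * D * H) by intros; ring, ← h]
    congr 1
    ext x
    have : Real.cosh (β * |x|) = Real.cosh (β * x) := by
      rcases abs_choice x with h | h <;> rw [h]
      rw [mul_neg, Real.cosh_neg]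
    simp only [hG]
    rw [this]
  have hGint : Integrable G := .of_integral_ne_zero (by rw [hGi]; positivity)
  have hEG : E = fun x => (Real.exp (β * x) / Real.cosh (β * x)) * G x := by
    ext x
    have := Real.cosh_pos (β * x)
    simp only [hE, hG]
    field_simp
  have hEint : Integrable E := by
    refine Integrable.mono' (hGint.const_mul 2) ?_ (Eventually.of_forall fun x => ?_)
    · rw [hEG]
      refine AEStronglyMeasurable.mul (Continuous.aestronglyMeasurable ?_) hGint.1
      exact Continuous.div (by fun_prop) (Real.continuous_cosh.comp (by fun_prop))
        (fun x => (Real.cosh_pos _).ne')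
    · have hB := besselK_nonneg (b - a) (c * |x|)
      have hA : 0 ≤ |x| ^ (a + b - 1) * besselK (b - a) (c * |x|) := by positivity
      simp only [hE, hG]
      rw [Real.norm_of_nonneg (by positivity), ← mul_assoc 2]
      refine mul_le_mul_of_nonneg_right ?_ hA
      rw [Real.cosh_eq]
      have := Real.exp_pos (-(β * x))
      linarith
  have hneg := integral_neg_eq_self E volume
  have hsum := integral_add hEint hEint.comp_neg
  rw [hneg] at hsum
  have h7 : ∀ x, E x + E (-x) = 2 * G x := by
    intro x
    simp only [hE, hG]
    rw [abs_neg, mul_neg, Real.cosh_eq]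
    ring
  simp_rw [h7] at hsum
  rw [integral_const_mul, hGi] at hsum
  linarith

theorem vg_abs_moment (ν α β : ℝ) (hν : ν > -1/2) (hβ : |β| < α)
    (k : ℝ) (hk : k > max (-1) (-2*ν - 1)) :
    ∫ x : ℝ, |x| ^ k * vgDensity ν α β x =
      2 ^ k * (1 - β ^ 2 / α ^ 2) ^ (ν + 1/2) /
          (Real.sqrt π * α ^ k * Real.Gamma (ν + 1/2)) *
        Real.Gamma (ν + (k + 1)/2) * Real.Gamma ((k + 1)/2) *
        hyp2F1 ((k + 1)/2) (ν + (k + 1)/2) (1/2) (β ^ 2 / α ^ 2) := by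
  have hα : 0 < α := lt_of_le_of_lt (abs_nonneg β) hβ
  have hk1 : k > -1 := lt_of_le_of_lt (le_max_left _ _) hk
  have hk2 : k > -2 * ν - 1 := lt_of_le_of_lt (le_max_right _ _) hk
  have ha : 0 < (k + 1) / 2 := by linarith
  have hb : 0 < ν + (k + 1) / 2 := by linarith
  have h := vg_line ha hb hα hβ
  have hz : 0 < 1 - β ^ 2 / α ^ 2 := by
    rw [sub_pos, div_lt_one (by positivity)]
    exact sq_lt_sq' (by linarith [neg_abs_le β]) (by linarith [le_abs_self β])
  set M := (α ^ 2 - β ^ 2) ^ (ν + 1/2) / (Real.sqrt π * (2 * α) ^ ν * Real.Gamma (ν + 1/2)) with hM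
  have hg := Real.Gamma_pos_of_pos (s := ν + 1/2) (by linarith)
  have e1 : (k + 1) / 2 + (ν + (k + 1) / 2) = k + ν + 1 := by ring
  have e2 : ν + (k + 1) / 2 - (k + 1) / 2 = ν := by ring
  rw [e1, e2, show k + ν + 1 - 1 = k + ν by ring] at h
  have hI : ∫ x : ℝ, |x| ^ k * vgDensity ν α β x =
      M * ∫ x : ℝ, Real.exp (β * x) * (|x| ^ (k + ν) * besselK ν (α * |x|)) := by
    rw [← integral_const_mul]
    refine integral_congr_ae ?_
    have : ∀ᵐ x : ℝ, x ≠ 0 := by simp [ae_iff, measure_singleton]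
    filter_upwards [this] with x hx
    rw [vgDensity, ← hM, Real.rpow_add (abs_pos.mpr hx)]
    ring
  rw [hI, h, hM, show α ^ 2 - β ^ 2 = α ^ 2 * (1 - β ^ 2 / α ^ 2) by field_simp,
    Real.mul_rpow (by positivity) hz.le, Real.mul_rpow (by norm_num) hα.le, ← Real.rpow_natCast α 2,
    ← Real.rpow_mul hα.le, Real.rpow_natCast α 2]
  have q1 : α ^ (((2:ℕ):ℝ) * (ν + 1/2)) = α ^ ν * α ^ ν * α := by
    rw [← Real.rpow_add hα, ← Real.rpow_add_one hα.ne']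
    congr 1; push_cast; ring
  have q2 : α ^ (-(k + ν + 1)) = (α ^ k * α ^ ν * α)⁻¹ := by
    rw [Real.rpow_neg hα.le, Real.rpow_add_one hα.ne', Real.rpow_add hα]
  rw [q1, q2, Real.rpow_add (by norm_num : (0:ℝ) < 2)]
  have : 0 < α ^ k := by positivity
  have : 0 < α ^ ν := by positivity
  have : (0:ℝ) < 2 ^ ν := by positivity
  have : 0 < Real.sqrt π := by positivity
  generalize (1 - β ^ 2 / α ^ 2) ^ (ν + 1/2) = Z
  generalize hyp2F1 ((k + 1)/2) (ν + (k + 1)/2) (1/2) (β ^ 2 / α ^ 2) = H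
  field_simp
end

section
/- Let ν > -1/2 and 0 ≤ |β| < α, and let p be the variance-gamma density with parameters (ν, α, β, 0). For every positive integer k, set ℓ = ⌈k/2⌉ + 1/2 and m = k mod 2. Then the k-th moment satisfies ∫_ℝ x^k p(x) dx = (2^k (2β/α)^m (1 - β²/α²)^{ν+1/2} / (√π α^k Γ(ν+1/2))) · Γ(ν + ℓ) Γ(ℓ) · ₂F₁(ℓ, ν + ℓ; 1/2 + m; β²/α²). -/
open MeasureTheory Real Filter

/-- The kernel obtained from the Bessel integral after the substitution `w = x e^t`. -/
noncomputable def vgKer (ν c w : ℝ) : ℝ :=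
  w ^ (ν - 1) * Real.exp (-(1/2) * w) * Real.exp (-(c / (2 * w)))

lemma vgKer_integrable (ν c : ℝ) (hν : -1/2 < ν) (hc : 0 < c) :
    IntegrableOn (vgKer ν c) (Set.Ioi 0) := by
  have h1 : IntegrableOn (fun w : ℝ => w ^ ν * Real.exp (-(1/2) * w ^ (1:ℝ))) (Set.Ioi 0) :=
    integrableOn_rpow_mul_exp_neg_mul_rpow (by linarith) one_pos (by norm_num)
  refine Integrable.mono' (h1.const_mul (2 / c)) ?_ ?_
  · have : Measurable (vgKer ν c) := by unfold vgKer; fun_prop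
    exact this.aestronglyMeasurable
  · refine (ae_restrict_iff' measurableSet_Ioi).2 (Eventually.of_forall fun w hw => ?_)
    have hw : 0 < w := hw
    have hy : 0 < c / (2 * w) := by positivity
    have h2 : Real.exp (-(c / (2 * w))) ≤ 2 * w / c := by
      rw [Real.exp_neg, ← inv_div c (2 * w)]
      apply inv_anti₀ hy
      linarith [Real.add_one_le_exp (c / (2 * w))]
    unfold vgKer
    rw [Real.norm_of_nonneg (by positivity), Real.rpow_one]
    have h3 : w ^ ν = w ^ (ν - 1) * w := by
      rw [← Real.rpow_add_one hw.ne']; ring_nf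
    rw [h3]
    calc _ ≤ w ^ (ν - 1) * Real.exp (-(1/2) * w) * (2 * w / c) := by gcongr
      _ = _ := by ring

lemma vg_image (x : ℝ) (hx : 0 < x) : (fun t => x * Real.exp t) '' Set.univ = Set.Ioi 0 := by
  ext w
  simp only [Set.image_univ, Set.mem_range, Set.mem_Ioi]
  constructor
  · rintro ⟨t, rfl⟩; positivity
  · intro hw
    refine ⟨Real.log (w / x), ?_⟩
    rw [Real.exp_log (by positivity)]; field_simp

lemma vgKer_subst (ν x t : ℝ) (hx : 0 < x) :
    |x * Real.exp t| • vgKer ν (x ^ 2) (x * Real.exp t)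
      = x ^ ν * (Real.exp (-x * Real.cosh t) * Real.exp (ν * t)) := by
  have he : 0 < Real.exp t := Real.exp_pos t
  have hw : 0 < x * Real.exp t := by positivity
  rw [abs_of_pos hw, smul_eq_mul]
  unfold vgKer
  rw [← mul_assoc, ← mul_assoc]
  have h3 : x * Real.exp t * (x * Real.exp t) ^ (ν - 1) = x ^ ν * Real.exp (ν * t) := by
    rw [mul_comm, ← Real.rpow_add_one hw.ne', Real.mul_rpow hx.le he.le, ← Real.exp_mul]
    ring_nf
  rw [h3, mul_assoc (x ^ ν * _), ← Real.exp_add]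
  have : -(1/2) * (x * Real.exp t) + -(x ^ 2 / (2 * (x * Real.exp t))) = -x * Real.cosh t := by
    rw [Real.cosh_eq, Real.exp_neg]; field_simp; ring
  rw [this]; ring

lemma bessel_exp_integrable (ν x : ℝ) (hν : -1/2 < ν) (hx : 0 < x) :
    Integrable (fun t => Real.exp (-x * Real.cosh t) * Real.exp (ν * t)) := by
  have h := (integrableOn_image_iff_integrableOn_abs_deriv_smul (s := Set.univ)
    (f := fun t => x * Real.exp t) (f' := fun t => x * Real.exp t) MeasurableSet.univ
    (fun t _ => ((Real.hasDerivAt_exp t).const_mul x).hasDerivWithinAt)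
    (fun a _ b _ hab => by simpa [hx.ne'] using hab) (vgKer ν (x ^ 2)))
  rw [vg_image x hx] at h
  have h2 := h.1 (vgKer_integrable ν (x ^ 2) hν (by positivity))
  rw [integrableOn_univ] at h2
  simp only [vgKer_subst ν x _ hx] at h2
  have := h2.const_mul (x ^ ν)⁻¹
  have hp : x ^ ν ≠ 0 := (Real.rpow_pos_of_pos hx ν).ne'
  simpa [hp] using this

lemma bessel_exp_integral (ν x : ℝ) (hx : 0 < x) :
    ∫ w in Set.Ioi (0:ℝ), vgKer ν (x ^ 2) w
      = x ^ ν * ∫ t, Real.exp (-x * Real.cosh t) * Real.exp (ν * t) := by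
  have h := (integral_image_eq_integral_abs_deriv_smul (s := Set.univ)
    (f := fun t => x * Real.exp t) (f' := fun t => x * Real.exp t) MeasurableSet.univ
    (fun t _ => ((Real.hasDerivAt_exp t).const_mul x).hasDerivWithinAt)
    (fun a _ b _ hab => by simpa [hx.ne'] using hab) (vgKer ν (x ^ 2)))
  rw [vg_image x hx] at h
  rw [h, setIntegral_univ]
  simp only [vgKer_subst ν x _ hx]
  rw [integral_const_mul]

lemma bessel_integrable (ν x : ℝ) (hν : -1/2 < ν) (hx : 0 < x) :
    Integrable (fun t => Real.exp (-x * Real.cosh t) * Real.cosh (ν * t)) := by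
  have h1 := bessel_exp_integrable ν x hν hx
  have h2 := h1.comp_neg
  convert (h1.add h2).const_mul (1/2) using 1
  ext t
  simp only [Pi.add_apply, Real.cosh_neg, Real.cosh_eq (ν * t)]
  ring_nf

lemma besselK_eq (ν x : ℝ) (hν : -1/2 < ν) (hx : 0 < x) :
    x ^ ν * besselK ν x = 1/2 * ∫ w in Set.Ioi (0:ℝ), vgKer ν (x ^ 2) w := by
  have h1 := bessel_exp_integrable ν x hν hx
  have h2 := h1.comp_neg
  have e1 : ∫ t, Real.exp (-x * Real.cosh t) * Real.cosh (ν * t) = 2 * besselK ν x := by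
    unfold besselK
    rw [← integral_comp_abs]
    congr 1; ext t
    rw [Real.cosh_abs]
    congr 1
    rw [← Real.cosh_abs (ν * t), ← Real.cosh_abs (ν * |t|), abs_mul, abs_mul, abs_abs]
  have e2 : ∫ t, Real.exp (-x * Real.cosh t) * Real.cosh (ν * t)
      = ∫ t, Real.exp (-x * Real.cosh t) * Real.exp (ν * t) := by
    have : (fun t => Real.exp (-x * Real.cosh t) * Real.cosh (ν * t)) = fun t =>
      (1/2) * (Real.exp (-x * Real.cosh t) * Real.exp (ν * t)
        + Real.exp (-x * Real.cosh (-t)) * Real.exp (ν * (-t))) := by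
      ext t
      simp only [Real.cosh_neg, Real.cosh_eq (ν * t)]
      ring_nf
    rw [this, integral_const_mul, integral_add h1 h2,
      integral_neg_eq_self (fun t => Real.exp (-x * Real.cosh t) * Real.exp (ν * t))]
    ring
  rw [bessel_exp_integral ν x hx, ← e2, e1]; ring

lemma inner_x (α w : ℝ) (r : ℕ) (hα : 0 < α) (hw : 0 < w) :
    IntegrableOn (fun x : ℝ => x ^ r * Real.exp (-((α * x) ^ 2 / (2 * w)))) (Set.Ioi 0) ∧
    ∫ x in Set.Ioi (0:ℝ), x ^ r * Real.exp (-((α * x) ^ 2 / (2 * w)))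
      = (2 / α ^ 2) ^ (((r:ℝ) + 1) / 2) * w ^ (((r:ℝ) + 1) / 2)
          * (1/2) * Real.Gamma (((r:ℝ) + 1) / 2) := by
  have hb : 0 < α ^ 2 / (2 * w) := by positivity
  have hr : (-1:ℝ) < r := by have : (0:ℝ) ≤ r := r.cast_nonneg; linarith
  have h1 := integrableOn_rpow_mul_exp_neg_mul_rpow hr two_pos hb
  have h2 := integral_rpow_mul_exp_neg_mul_rpow two_pos hr hb
  have e : (fun x : ℝ => x ^ (r:ℝ) * Real.exp (-(α ^ 2 / (2 * w)) * x ^ (2:ℝ)))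
      = fun x : ℝ => x ^ r * Real.exp (-((α * x) ^ 2 / (2 * w))) := by
    ext x
    rw [Real.rpow_natCast, Real.rpow_two]
    congr 2; ring
  rw [e] at h1 h2
  refine ⟨h1, h2.trans ?_⟩
  rw [neg_div, Real.rpow_neg hb.le, ← Real.inv_rpow hb.le, inv_div,
    mul_div_right_comm, Real.mul_rpow (by positivity) hw.le]

lemma besselK_mellin (ν α : ℝ) (r : ℕ) (hν : -1/2 < ν) (hα : 0 < α) :
    IntegrableOn (fun x : ℝ => x ^ r * (x ^ ν * besselK ν (α * x))) (Set.Ioi 0) ∧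
    ∫ x in Set.Ioi (0:ℝ), x ^ r * (x ^ ν * besselK ν (α * x))
      = 2 ^ r * 2 ^ ν / (2 * α ^ ν * α ^ (r + 1)) * Real.Gamma (((r:ℝ) + 1) / 2)
        * Real.Gamma (ν + ((r:ℝ) + 1) / 2) := by
  set A : ℝ := ((r:ℝ) + 1) / 2 with hA
  have hA0 : 1/2 ≤ A := by have : (0:ℝ) ≤ r := r.cast_nonneg; rw [hA]; linarith
  set C : ℝ := (2 / α ^ 2) ^ A * (1/2) * Real.Gamma A with hC
  let F : ℝ → ℝ → ℝ := fun x w => x ^ r * vgKer ν ((α * x) ^ 2) w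
  have hF : ∀ x w, F x w = w ^ (ν - 1) * Real.exp (-(1/2) * w) *
      (x ^ r * Real.exp (-((α * x) ^ 2 / (2 * w)))) := by
    intro x w; simp only [F, vgKer]; ring
  have hFi : ∀ w, 0 < w → ∫ x in Set.Ioi (0:ℝ), F x w
      = C * (w ^ (ν + A - 1) * Real.exp (-((1/2) * w))) := by
    intro w hw
    simp only [hF]
    rw [integral_const_mul, (inner_x α w r hα hw).2,
      show ν + A - 1 = (ν - 1) + A by ring, Real.rpow_add hw, hC, neg_mul]
    ring
  have hmeas : Measurable (Function.uncurry F) := by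
    simp only [F, vgKer, Function.uncurry_def]; fun_prop
  have hw1 : IntegrableOn (fun w : ℝ => w ^ (ν + A - 1) * Real.exp (-((1/2) * w)))
      (Set.Ioi 0) := by
    have := integrableOn_rpow_mul_exp_neg_mul_rpow (s := ν + A - 1) (p := 1) (b := 1/2)
      (by linarith) one_pos (by norm_num)
    simpa only [Real.rpow_one, neg_mul] using this
  have hint : Integrable (Function.uncurry F)
      ((volume.restrict (Set.Ioi (0:ℝ))).prod (volume.restrict (Set.Ioi (0:ℝ)))) := by
    rw [integrable_prod_iff' hmeas.aestronglyMeasurable]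
    constructor
    · refine (ae_restrict_iff' measurableSet_Ioi).2 (Eventually.of_forall fun w hw => ?_)
      simp only [Function.uncurry_apply_pair, hF]
      exact (inner_x α w r hα hw).1.const_mul _
    · refine Integrable.congr (hw1.const_mul C) ?_
      refine (ae_restrict_iff' measurableSet_Ioi).2 (Eventually.of_forall fun w hw => ?_)
      have hw : 0 < w := hw
      simp only [← hFi w hw, Function.uncurry_apply_pair]
      refine setIntegral_congr_fun measurableSet_Ioi fun x hx => ?_
      have hx : 0 < x := hx
      rw [Real.norm_of_nonneg]
      rw [hF]; positivity
  have hK : ∀ x, 0 < x → x ^ r * (x ^ ν * besselK ν (α * x))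
      = 1/2 * (α ^ ν)⁻¹ * ∫ w in Set.Ioi (0:ℝ), F x w := by
    intro x hx
    have := besselK_eq ν (α * x) hν (by positivity)
    rw [Real.mul_rpow hα.le hx.le] at this
    simp only [F]
    rw [integral_const_mul]
    have hp : α ^ ν ≠ 0 := (Real.rpow_pos_of_pos hα ν).ne'
    have h2 : x ^ ν * besselK ν (α * x) = (α ^ ν)⁻¹ * (α ^ ν * x ^ ν * besselK ν (α * x)) := by
      field_simp
    rw [h2, this]; ring
  constructor
  · refine Integrable.congr (hint.integral_prod_left.const_mul (1/2 * (α ^ ν)⁻¹)) ?_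
    refine (ae_restrict_iff' measurableSet_Ioi).2 (Eventually.of_forall fun x hx => ?_)
    exact (hK x hx).symm
  · rw [setIntegral_congr_fun measurableSet_Ioi (fun x hx => hK x hx), integral_const_mul,
      integral_integral_swap hint, setIntegral_congr_fun measurableSet_Ioi (fun w hw => hFi w hw),
      integral_const_mul, Real.integral_rpow_mul_exp_neg_mul_Ioi (by linarith) (by norm_num), hC]
    have e1 : (2 / α ^ 2) ^ A = 2 ^ A / α ^ (r + 1) := by
      rw [Real.div_rpow (by norm_num) (by positivity), ← Real.rpow_natCast α 2,
        ← Real.rpow_mul hα.le, ← Real.rpow_natCast α (r + 1)]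
      congr 2; rw [hA]; push_cast; ring
    have e2 : (1 / (1 / 2 : ℝ)) ^ (ν + A) = 2 ^ ν * 2 ^ A := by
      rw [one_div_one_div, Real.rpow_add two_pos]
    have e3 : (2:ℝ) ^ A * 2 ^ A = 2 ^ r * 2 := by
      rw [← Real.rpow_add two_pos, ← pow_succ, ← Real.rpow_natCast 2 (r+1)]
      congr 1; rw [hA]; push_cast; ring
    rw [e1, e2]
    have hp : α ^ ν ≠ 0 := (Real.rpow_pos_of_pos hα ν).ne'
    field_simp
    linear_combination Real.Gamma (ν + A) * e3

lemma integrable_abs_of_Ioi (f : ℝ → ℝ) (hf : IntegrableOn f (Set.Ioi 0)) :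
    Integrable (fun x => f |x|) := by
  have h1 : IntegrableOn (fun x => f |x|) (Set.Ioi 0) :=
    hf.congr_fun (fun x hx => by rw [abs_of_pos hx]) measurableSet_Ioi
  have h2 : IntegrableOn (fun x => f |x|) (Set.Iic 0) := by
    have : IntegrableOn (fun x => f |x|) (Set.Ici (-0)) := by
      rw [neg_zero, integrableOn_Ici_iff_integrableOn_Ioi]; exact h1
    simpa using this.comp_neg_Iic
  rw [← integrableOn_univ, ← Set.Iic_union_Ioi (a := (0:ℝ))]
  exact h2.union h1

lemma besselK_exp_le (ν α b x : ℝ) (hν : -1/2 < ν) (hb : 0 ≤ b) (hbα : b < α) (hx : 0 < x) :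
    Real.exp (b * x) * besselK ν (α * x) ≤ besselK ν ((α - b) * x) := by
  unfold besselK
  rw [← integral_const_mul]
  have h1 := bessel_integrable ν (α * x) hν (mul_pos (hb.trans_lt hbα) hx)
  have h2 := bessel_integrable ν ((α - b) * x) hν (mul_pos (by linarith) hx)
  refine setIntegral_mono_on (h1.const_mul _).integrableOn h2.integrableOn measurableSet_Ioi ?_
  intro t _
  rw [← mul_assoc, ← Real.exp_add]
  have := Real.one_le_cosh t
  have hc := (Real.cosh_pos (ν * t)).le
  gcongr
  nlinarith [mul_nonneg (mul_nonneg hb hx.le) (sub_nonneg.2 this)]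

lemma vg_W_meas (ν α : ℝ) (hν : -1/2 < ν) (hα : 0 < α) :
    AEStronglyMeasurable (fun x : ℝ => |x| ^ ν * besselK ν (α * |x|)) := by
  have := (integrable_abs_of_Ioi _ (besselK_mellin ν α 0 hν hα).1).aestronglyMeasurable
  simpa using this

lemma vg_bound_integrable (ν α β : ℝ) (k : ℕ) (hν : -1/2 < ν) (hβ : |β| < α) :
    Integrable (fun x : ℝ => Real.exp (|β| * |x|) * (|x| ^ k * (|x| ^ ν * besselK ν (α * |x|)))) := by
  have hα : 0 < α := (abs_nonneg β).trans_lt hβ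
  have h1 := integrable_abs_of_Ioi _ (besselK_mellin ν (α - |β|) k hν (by linarith)).1
  refine Integrable.mono' h1 ?_ ?_
  · refine AEStronglyMeasurable.mul ?_ (AEStronglyMeasurable.mul ?_ (vg_W_meas ν α hν hα))
    · exact Continuous.aestronglyMeasurable (by fun_prop)
    · exact Continuous.aestronglyMeasurable (by fun_prop)
  · have h0 : ∀ᵐ x : ℝ, x ≠ 0 := by simp [ae_iff]
    filter_upwards [h0] with x hx
    have hx : 0 < |x| := abs_pos.2 hx
    have hn := besselK_nonneg ν (α * |x|)
    rw [Real.norm_of_nonneg (by positivity)]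
    calc _ = |x| ^ k * (|x| ^ ν * (Real.exp (|β| * |x|) * besselK ν (α * |x|))) := by ring
      _ ≤ _ := by gcongr; exact besselK_exp_le ν α |β| |x| hν (abs_nonneg _) hβ hx

lemma vg_hasSum (ν α β : ℝ) (k : ℕ) (hν : -1/2 < ν) (hβ : |β| < α) :
    HasSum (fun n : ℕ => ∫ x : ℝ, (β * x) ^ n / n.factorial *
        (x ^ k * (|x| ^ ν * besselK ν (α * |x|))))
      (∫ x : ℝ, Real.exp (β * x) * (x ^ k * (|x| ^ ν * besselK ν (α * |x|)))) := by
  have hα : 0 < α := (abs_nonneg β).trans_lt hβ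
  have hexp : ∀ y : ℝ, HasSum (fun n : ℕ => y ^ n / n.factorial) (Real.exp y) := by
    intro y
    rw [Real.exp_eq_exp_ℝ]
    exact NormedSpace.expSeries_div_hasSum_exp y
  have hb : ∀ x : ℝ, HasSum (fun n : ℕ => (|β| * |x|) ^ n / n.factorial *
        (|x| ^ k * (|x| ^ ν * besselK ν (α * |x|))))
      (Real.exp (|β| * |x|) * (|x| ^ k * (|x| ^ ν * besselK ν (α * |x|)))) :=
    fun x => (hexp _).mul_right _
  refine hasSum_integral_of_dominated_convergence
    (fun (n : ℕ) (x : ℝ) => (|β| * |x|) ^ n / n.factorial *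
        (|x| ^ k * (|x| ^ ν * besselK ν (α * |x|)))) ?_ ?_ ?_ ?_ ?_
  · intro n
    refine AEStronglyMeasurable.mul ?_ (AEStronglyMeasurable.mul ?_ (vg_W_meas ν α hν hα))
    · exact Continuous.aestronglyMeasurable (by fun_prop)
    · exact Continuous.aestronglyMeasurable (by fun_prop)
  · intro n
    refine Eventually.of_forall fun x => ?_
    have hn := besselK_nonneg ν (α * |x|)
    have hp : 0 ≤ |x| ^ ν := by positivity
    simp only [norm_mul, norm_div, norm_pow, Real.norm_eq_abs, abs_of_nonneg hn, abs_of_nonneg hp,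
      Nat.abs_cast, le_refl]
  · exact Eventually.of_forall fun x => (hb x).summable
  · simp only [fun x => (hb x).tsum_eq]
    exact vg_bound_integrable ν α β k hν hβ
  · exact Eventually.of_forall fun x => (hexp _).mul_right _

lemma vg_odd (W : ℝ → ℝ) (r : ℕ) (hr : Odd r) : ∫ x : ℝ, x ^ r * W |x| = 0 := by
  have h := integral_neg_eq_self (fun x : ℝ => x ^ r * W |x|) volume
  simp only [hr.neg_pow, abs_neg, neg_mul, integral_neg] at h
  linarith

lemma vg_even (W : ℝ → ℝ) (r : ℕ) (hr : Even r) :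
    ∫ x : ℝ, x ^ r * W |x| = 2 * ∫ x in Set.Ioi (0:ℝ), x ^ r * W x := by
  rw [← integral_comp_abs]
  congr 1; ext x
  rw [hr.pow_abs]

lemma Gamma_asc (u : ℝ) (hu : 0 < u) (j : ℕ) :
    Real.Gamma (u + j) = Real.Gamma u * ascFactorial u j := by
  induction j with
  | zero => simp [ascFactorial]
  | succ j ih =>
    have : u + j ≠ 0 := by positivity
    push_cast
    rw [← add_assoc, Real.Gamma_add_one this, ih]
    unfold ascFactorial
    rw [Finset.prod_range_succ]; ring

lemma asc_pos (u : ℝ) (hu : 0 < u) (j : ℕ) : 0 < ascFactorial u j :=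
  Finset.prod_pos fun i _ => by positivity

lemma fact_asc (m : ℕ) (hm : m = 0 ∨ m = 1) (j : ℕ) :
    ((2 * j + m).factorial : ℝ) = 4 ^ j * j.factorial * ascFactorial (1/2 + (m:ℝ)) j := by
  induction j with
  | zero => rcases hm with rfl | rfl <;> simp [ascFactorial]
  | succ j ih =>
    have e : ascFactorial (1/2 + (m:ℝ)) (j+1) = ascFactorial (1/2 + (m:ℝ)) j * (1/2 + (m:ℝ) + j) := by
      unfold ascFactorial; rw [Finset.prod_range_succ]
    rw [show 2 * (j+1) + m = (2 * j + m) + 1 + 1 by ring, Nat.factorial_succ, Nat.factorial_succ,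
      Nat.factorial_succ, e]
    push_cast
    rw [ih]
    rcases hm with rfl | rfl <;> push_cast <;> ring

lemma vg_term (ν α β : ℝ) (k q m j : ℕ) (hν : -1/2 < ν) (hβ : |β| < α) (hkq : k + m = 2 * q)
    (hm : m = 0 ∨ m = 1) :
    ∫ x : ℝ, (β * x) ^ (2 * j + m) / (2 * j + m).factorial *
        (x ^ k * (|x| ^ ν * besselK ν (α * |x|)))
      = 2 ^ k * (2 * β / α) ^ m * 2 ^ ν / (α ^ ν * α * α ^ k)
        * Real.Gamma (ν + (q + 1/2)) * Real.Gamma ((q:ℝ) + 1/2) *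
        (ascFactorial ((q:ℝ) + 1/2) j * ascFactorial (ν + (q + 1/2)) j /
          ascFactorial (1/2 + (m:ℝ)) j * (β ^ 2 / α ^ 2) ^ j / (Nat.factorial j)) := by
  have hα : 0 < α := (abs_nonneg β).trans_lt hβ
  have e1 : ∀ x : ℝ, (β * x) ^ (2 * j + m) / (2 * j + m).factorial *
        (x ^ k * (|x| ^ ν * besselK ν (α * |x|)))
      = β ^ (2 * j + m) / (2 * j + m).factorial *
        (x ^ (2 * q + 2 * j) * (|x| ^ ν * besselK ν (α * |x|))) := by
    intro x
    rw [← hkq]; ring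
  simp only [e1]
  rw [integral_const_mul, vg_even (fun x => x ^ ν * besselK ν (α * x)) _ ⟨q + j, by ring⟩,
    (besselK_mellin ν α _ hν hα).2]
  have hq : (0:ℝ) ≤ q := q.cast_nonneg
  have e2 : (((2 * q + 2 * j : ℕ) : ℝ) + 1) / 2 = (q:ℝ) + 1/2 + j := by push_cast; ring
  rw [e2, ← add_assoc ν, Gamma_asc _ (by linarith), Gamma_asc _ (by linarith), fact_asc m hm,
    show 2 * q + 2 * j = k + m + 2 * j by omega]
  have hp : α ^ ν ≠ 0 := (Real.rpow_pos_of_pos hα ν).ne'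
  have ha := (asc_pos (1/2 + (m:ℝ)) (by positivity) j).ne'
  have hf : (j.factorial : ℝ) ≠ 0 := by positivity
  have e4 : (4:ℝ) ^ j = 2 ^ (2 * j) := by rw [pow_mul]; norm_num
  rw [e4]
  simp only [div_pow, mul_pow, pow_add, pow_one, ← pow_mul]
  field_simp

theorem vg_moment (ν α β : ℝ) (hν : ν > -1/2) (hβ : |β| < α) (k : ℕ) (hk : 0 < k) :
    ∫ x : ℝ, x ^ k * vgDensity ν α β x =
      2 ^ k * (2 * β / α) ^ (k % 2) * (1 - β ^ 2 / α ^ 2) ^ (ν + 1/2) /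
          (Real.sqrt π * α ^ k * Real.Gamma (ν + 1/2)) *
        Real.Gamma (ν + ((⌈(k : ℝ)/2⌉₊ : ℝ) + 1/2)) * Real.Gamma ((⌈(k : ℝ)/2⌉₊ : ℝ) + 1/2) *
        hyp2F1 ((⌈(k : ℝ)/2⌉₊ : ℝ) + 1/2) (ν + ((⌈(k : ℝ)/2⌉₊ : ℝ) + 1/2))
          (1/2 + (k % 2 : ℕ)) (β ^ 2 / α ^ 2) := by
  have hα : 0 < α := (abs_nonneg β).trans_lt hβ
  obtain ⟨q, m, hm, hkq, hkm, hq⟩ : ∃ q m : ℕ, (m = 0 ∨ m = 1) ∧ k + m = 2 * q ∧ k % 2 = m ∧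
      ⌈(k : ℝ)/2⌉₊ = q := by
    refine ⟨(k + k % 2) / 2, k % 2, by omega, by omega, rfl, ?_⟩
    have h1 : k + k % 2 = 2 * ((k + k % 2) / 2) := by omega
    set q := (k + k % 2) / 2
    have hq0 : q ≠ 0 := by omega
    rw [Nat.ceil_eq_iff hq0]
    have h2 : k ≤ 2 * q := by omega
    have h3 : 2 * (q - 1) < k := by omega
    have h2' : (k:ℝ) ≤ 2 * q := by exact_mod_cast h2
    have h3' : 2 * ((q - 1 : ℕ) : ℝ) < k := by exact_mod_cast h3
    constructor <;> linarith
  rw [hq, hkm]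
  have hs := vg_hasSum ν α β k hν hβ
  have hinj : Function.Injective (fun j : ℕ => 2 * j + m) := fun a b h => by
    simp only at h; omega
  rw [← hinj.hasSum_iff] at hs
  · have hv := hs.tsum_eq
    simp only [Function.comp_def, fun j => vg_term ν α β k q m j hν hβ hkq hm] at hv
    rw [tsum_mul_left] at hv
    change _ * hyp2F1 _ _ _ _ = _ at hv
    have e : ∀ x : ℝ, x ^ k * vgDensity ν α β x
        = (α ^ 2 - β ^ 2) ^ (ν + 1/2) / (Real.sqrt π * (2 * α) ^ ν * Real.Gamma (ν + 1/2)) *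
          (Real.exp (β * x) * (x ^ k * (|x| ^ ν * besselK ν (α * |x|)))) := by
      intro x; unfold vgDensity; ring
    simp only [e]
    rw [integral_const_mul, ← hv]
    have hβ2 : β ^ 2 < α ^ 2 := sq_lt_sq' (by linarith [neg_abs_le β]) (by linarith [le_abs_self β])
    have e1 : (1 - β ^ 2 / α ^ 2) ^ (ν + 1/2)
        = (α ^ 2 - β ^ 2) ^ (ν + 1/2) / (α ^ ν * α ^ ν * α) := by
      rw [show 1 - β ^ 2 / α ^ 2 = (α ^ 2 - β ^ 2) / α ^ 2 by field_simp,
        Real.div_rpow (by linarith) (by positivity)]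
      congr 1
      rw [← Real.rpow_natCast α 2, ← Real.rpow_mul hα.le, ← Real.rpow_add hα,
        ← Real.rpow_add_one hα.ne']
      congr 1; push_cast; ring
    rw [e1, Real.mul_rpow two_pos.le hα.le]
    have hp : α ^ ν ≠ 0 := (Real.rpow_pos_of_pos hα ν).ne'
    have hp2 : (2:ℝ) ^ ν ≠ 0 := (Real.rpow_pos_of_pos two_pos ν).ne'
    have hg : Real.Gamma (ν + 1/2) ≠ 0 := (Real.Gamma_pos_of_pos (by linarith)).ne'
    have hpi : Real.sqrt π ≠ 0 := by positivity
    generalize (α ^ 2 - β ^ 2) ^ (ν + 1/2) = D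
    generalize Real.Gamma (ν + 1/2) = G at *
    generalize hyp2F1 _ _ _ _ = H
    generalize Real.Gamma (ν + (q + 1/2)) = G1
    generalize Real.Gamma ((q:ℝ) + 1/2) = G2
    field_simp
  · intro n hn
    have hodd : Odd (k + n) := by
      by_contra hcon
      rw [Nat.not_odd_iff_even] at hcon
      apply hn
      obtain ⟨a, ha⟩ := hcon
      exact ⟨(n - m) / 2, by simp only; omega⟩
    have e : ∀ x : ℝ, (β * x) ^ n / n.factorial * (x ^ k * (|x| ^ ν * besselK ν (α * |x|)))
        = β ^ n / n.factorial * (x ^ (k + n) * (|x| ^ ν * besselK ν (α * |x|))) := by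
      intro x; ring
    simp only [e]
    rw [integral_const_mul, vg_odd (fun x => x ^ ν * besselK ν (α * x)) _ hodd, mul_zero]
end

section
/- Let ν > -1/2 and α > 0, and let p be the variance-gamma density with parameters (ν, α, 0, 0), i.e. with β = 0. Then for every real k > k_* = max{-1, -2ν-1}, ∫_ℝ |x|^k p(x) dx = (2^k / (√π α^k)) · Γ(ν + (k+1)/2) Γ((k+1)/2) / Γ(ν + 1/2). -/
open MeasureTheory Real Filter

theorem bessel_aux (ν c : ℝ) (hc : 0 < c)
    (hint : IntegrableOn (fun w : ℝ => w ^ (ν - 1) * Real.exp (-w - c ^ 2 / w)) (Set.Ioi 0)) :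
    ∫ w in Set.Ioi (0 : ℝ), w ^ (ν - 1) * Real.exp (-w - c ^ 2 / w) =
      2 * c ^ ν * besselK ν (2 * c) := by
  have himg : (fun t : ℝ => c * Real.exp t) '' Set.univ = Set.Ioi 0 := by
    ext w
    simp only [Set.image_univ, Set.mem_range, Set.mem_Ioi]
    constructor
    · rintro ⟨t, rfl⟩
      positivity
    · intro hw
      refine ⟨Real.log (w / c), ?_⟩
      rw [Real.exp_log (by positivity)]
      field_simp
  have hder : ∀ x ∈ (Set.univ : Set ℝ),
      HasDerivWithinAt (fun t : ℝ => c * Real.exp t) (c * Real.exp x) Set.univ x := fun x _ =>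
    ((Real.hasDerivAt_exp x).const_mul c).hasDerivWithinAt
  have hinj : Set.InjOn (fun t : ℝ => c * Real.exp t) Set.univ := by
    intro a _ b _ h
    exact Real.exp_injective (mul_left_cancel₀ hc.ne' h)
  have hpt : ∀ t : ℝ, |c * Real.exp t| • ((c * Real.exp t) ^ (ν - 1) *
      Real.exp (-(c * Real.exp t) - c ^ 2 / (c * Real.exp t))) =
      c ^ ν * (Real.exp (-(2 * c) * Real.cosh t) * Real.exp (ν * t)) := by
    intro t
    have hp : 0 < c * Real.exp t := by positivity
    have h1 : -(c * Real.exp t) - c ^ 2 / (c * Real.exp t) = -(2 * c) * Real.cosh t := by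
      rw [Real.cosh_eq, Real.exp_neg]
      field_simp
      ring
    have h2 : (c * Real.exp t) * (c * Real.exp t) ^ (ν - 1) = c ^ ν * Real.exp (ν * t) := by
      rw [Real.rpow_sub_one hp.ne', Real.mul_rpow hc.le (Real.exp_pos t).le, ← Real.exp_mul,
        mul_comm t ν]
      field_simp
    rw [abs_of_pos hp, smul_eq_mul, h1, ← mul_assoc, h2]
    ring
  rw [← himg] at hint ⊢
  rw [integrableOn_image_iff_integrableOn_abs_deriv_smul MeasurableSet.univ hder hinj,
    integrableOn_univ] at hint
  rw [integral_image_eq_integral_abs_deriv_smul MeasurableSet.univ hder hinj, setIntegral_univ]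
  simp only [hpt] at hint ⊢
  rw [integral_const_mul]
  have hcν : c ^ ν ≠ 0 := (Real.rpow_pos_of_pos hc ν).ne'
  have hG : Integrable (fun t : ℝ => Real.exp (-(2 * c) * Real.cosh t) * Real.exp (ν * t)) := by
    have := hint.const_mul (c ^ ν)⁻¹
    refine this.congr (Eventually.of_forall fun t => ?_)
    simp only
    field_simp
  have hsymm : ∫ t : ℝ, Real.exp (-(2 * c) * Real.cosh t) * Real.exp (ν * t) =
      ∫ t : ℝ, Real.exp (-(2 * c) * Real.cosh t) * Real.cosh (ν * t) := by
    have e := integral_neg_eq_self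
      (fun t : ℝ => Real.exp (-(2 * c) * Real.cosh t) * Real.exp (ν * t)) volume
    have hG' := hG.comp_neg
    have ha := integral_add hG hG'
    rw [e] at ha
    have hb : ∀ t : ℝ, Real.exp (-(2 * c) * Real.cosh t) * Real.cosh (ν * t) =
        (1 / 2) * (Real.exp (-(2 * c) * Real.cosh t) * Real.exp (ν * t) +
        Real.exp (-(2 * c) * Real.cosh (-t)) * Real.exp (ν * -t)) := by
      intro t
      rw [Real.cosh_neg, Real.cosh_eq (ν * t), mul_neg]
      ring
    simp only [hb]
    rw [integral_const_mul, ha]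
    ring
  have habs := integral_comp_abs
    (f := fun t : ℝ => Real.exp (-(2 * c) * Real.cosh t) * Real.cosh (ν * t))
  have hab : ∀ t : ℝ, Real.exp (-(2 * c) * Real.cosh |t|) * Real.cosh (ν * |t|) =
      Real.exp (-(2 * c) * Real.cosh t) * Real.cosh (ν * t) := by
    intro t
    rcases abs_choice t with h | h <;> rw [h] <;> simp [Real.cosh_neg]
  simp only [hab] at habs
  rw [hsymm, habs, besselK]
  ring

theorem inner_aux (ν α k w : ℝ) (hα : 0 < α) (hk : -1 < k) (hw : 0 < w) :
    IntegrableOn (fun x : ℝ => x ^ k * (w ^ (ν - 1) * Real.exp (-w - (α * x / 2) ^ 2 / w)))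
      (Set.Ioi 0) ∧
    ∫ x in Set.Ioi (0 : ℝ), x ^ k * (w ^ (ν - 1) * Real.exp (-w - (α * x / 2) ^ 2 / w)) =
      ((α / 2) ^ (-(k + 1)) * (1 / 2) * Real.Gamma ((k + 1) / 2)) *
        (Real.exp (-w) * w ^ ((ν + (k + 1) / 2) - 1)) := by
  have hb : 0 < (α / 2) ^ 2 / w := by positivity
  have hpt : ∀ x : ℝ, x ^ k * (w ^ (ν - 1) * Real.exp (-w - (α * x / 2) ^ 2 / w)) =
      (w ^ (ν - 1) * Real.exp (-w)) * (x ^ k * Real.exp (-((α / 2) ^ 2 / w) * x ^ (2 : ℝ))) := by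
    intro x
    have : -w - (α * x / 2) ^ 2 / w = -w + -((α / 2) ^ 2 / w) * x ^ (2 : ℝ) := by
      rw [Real.rpow_two]; ring
    rw [this, Real.exp_add]
    ring
  simp only [hpt]
  refine ⟨(integrableOn_rpow_mul_exp_neg_mul_rpow hk two_pos hb).const_mul _, ?_⟩
  rw [integral_const_mul, integral_rpow_mul_exp_neg_mul_rpow two_pos hk hb]
  have h1 : ((α / 2) ^ 2 / w) ^ (-(k + 1) / 2) = (α / 2) ^ (-(k + 1)) * w ^ ((k + 1) / 2) := by
    rw [Real.div_rpow (by positivity) hw.le, ← Real.rpow_two, ← Real.rpow_mul (by positivity),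
      div_eq_mul_inv, ← Real.rpow_neg hw.le]
    congr 2 <;> ring
  have h2 : w ^ ((ν + (k + 1) / 2) - 1) = w ^ (ν - 1) * w ^ ((k + 1) / 2) := by
    rw [← Real.rpow_add hw]; congr 1; ring
  rw [h1, h2]
  ring

theorem double_aux (ν α k : ℝ) (hα : 0 < α) (hk : -1 < k) (hk2 : 0 < ν + (k + 1) / 2) :
    ∫ x in Set.Ioi (0 : ℝ), x ^ k * (x ^ ν * besselK ν (α * x)) =
      (1 / 2) * (α / 2) ^ (-ν) * ((α / 2) ^ (-(k + 1)) * (1 / 2) * Real.Gamma ((k + 1) / 2) *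
        Real.Gamma (ν + (k + 1) / 2)) := by
  let F : ℝ → ℝ → ℝ := fun x w => x ^ k * (w ^ (ν - 1) * Real.exp (-w - (α * x / 2) ^ 2 / w))
  have hF : Integrable (Function.uncurry F)
      ((volume.restrict (Set.Ioi (0 : ℝ))).prod (volume.restrict (Set.Ioi (0 : ℝ)))) := by
    have hm : Measurable (Function.uncurry F) := by
      simp only [F, Function.uncurry_def]
      fun_prop
    rw [integrable_prod_iff' hm.aestronglyMeasurable]
    constructor
    · filter_upwards [ae_restrict_mem measurableSet_Ioi] with w hw
      exact (inner_aux ν α k w hα hk hw).1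
    · have hg := (Real.GammaIntegral_convergent hk2).const_mul
        ((α / 2) ^ (-(k + 1)) * (1 / 2) * Real.Gamma ((k + 1) / 2))
      refine hg.congr ?_
      filter_upwards [ae_restrict_mem measurableSet_Ioi] with w hw
      rw [← (inner_aux ν α k w hα hk hw).2]
      refine setIntegral_congr_fun measurableSet_Ioi fun x hx => ?_
      have hx : 0 < x := hx
      have hw : 0 < w := hw
      simp only [Function.uncurry, F]
      rw [Real.norm_of_nonneg (by positivity)]
  have hswap := integral_integral_swap hF
  have hR : ∫ w in Set.Ioi (0 : ℝ), ∫ x in Set.Ioi (0 : ℝ), F x w =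
      (α / 2) ^ (-(k + 1)) * (1 / 2) * Real.Gamma ((k + 1) / 2) *
        Real.Gamma (ν + (k + 1) / 2) := by
    rw [Real.Gamma_eq_integral hk2, ← integral_const_mul]
    exact setIntegral_congr_fun measurableSet_Ioi fun w hw => (inner_aux ν α k w hα hk hw).2
  rw [← hR, ← hswap, ← integral_const_mul]
  apply integral_congr_ae
  filter_upwards [ae_restrict_mem measurableSet_Ioi, hF.prod_right_ae] with x hx hi
  have hx : 0 < x := hx
  have hxk : x ^ k ≠ 0 := (Real.rpow_pos_of_pos hx k).ne'
  have hi2 : IntegrableOn (fun w : ℝ => w ^ (ν - 1) * Real.exp (-w - (α * x / 2) ^ 2 / w))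
      (Set.Ioi 0) := by
    refine (hi.const_mul (x ^ k)⁻¹).congr (Eventually.of_forall fun w => ?_)
    simp only [Function.uncurry, F]
    field_simp
  have hb := bessel_aux ν (α * x / 2) (by positivity) hi2
  simp only [F]
  rw [integral_const_mul, hb, show 2 * (α * x / 2) = α * x by ring,
    show α * x / 2 = (α / 2) * x by ring, Real.mul_rpow (by positivity) hx.le,
    Real.rpow_neg (by positivity)]
  have : (α / 2) ^ ν ≠ 0 := (Real.rpow_pos_of_pos (by positivity) ν).ne'
  field_simp

theorem vg_symmetric_abs_moment (ν α : ℝ) (hν : ν > -1/2) (hα : 0 < α)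
    (k : ℝ) (hk : k > max (-1) (-2*ν - 1)) :
    ∫ x : ℝ, |x| ^ k * vgDensity ν α 0 x =
      2 ^ k / (Real.sqrt π * α ^ k) *
        (Real.Gamma (ν + (k + 1)/2) * Real.Gamma ((k + 1)/2) / Real.Gamma (ν + 1/2)) := by
  have hk1 : -1 < k := lt_of_le_of_lt (le_max_left _ _) hk
  have hk2 : -2 * ν - 1 < k := lt_of_le_of_lt (le_max_right _ _) hk
  have habs := integral_comp_abs (f := fun x : ℝ => x ^ k * (x ^ ν * besselK ν (α * x)))
  have hpt : ∀ x : ℝ, |x| ^ k * vgDensity ν α 0 x =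
      ((α ^ 2) ^ (ν + 1/2) / (Real.sqrt π * (2 * α) ^ ν * Real.Gamma (ν + 1/2))) *
        (|x| ^ k * (|x| ^ ν * besselK ν (α * |x|))) := by
    intro x
    simp only [vgDensity, zero_mul, Real.exp_zero]
    rw [show α ^ 2 - 0 ^ 2 = α ^ 2 by ring]
    ring
  simp only [hpt]
  rw [integral_const_mul, habs, double_aux ν α k hα hk1 (by linarith)]
  have hG : Real.Gamma (ν + 1/2) ≠ 0 := (Real.Gamma_pos_of_pos (by linarith)).ne'
  have hπ : Real.sqrt π ≠ 0 := (Real.sqrt_pos.mpr Real.pi_pos).ne'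
  have h1 : (α ^ 2) ^ (ν + 1/2) = α ^ ν * α ^ ν * α := by
    rw [← Real.rpow_two, ← Real.rpow_mul hα.le, ← Real.rpow_add hα, ← Real.rpow_add_one hα.ne']
    congr 1
    ring
  have ha := (Real.rpow_pos_of_pos hα ν).ne'
  have hb := (Real.rpow_pos_of_pos hα k).ne'
  have hc := (Real.rpow_pos_of_pos (two_pos : (0 : ℝ) < 2) ν).ne'
  have hd := (Real.rpow_pos_of_pos (two_pos : (0 : ℝ) < 2) k).ne'
  rw [h1, Real.mul_rpow two_pos.le hα.le, Real.rpow_neg (by positivity),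
    Real.rpow_neg (by positivity), Real.rpow_add_one (by positivity),
    Real.div_rpow hα.le two_pos.le, Real.div_rpow hα.le two_pos.le]
  field_simp
end

section
/- Let ν > -1/2 and 0 ≤ |β| < α, and let p be the variance-gamma density with parameters (ν, α, β, 0). Then p is a probability density function, i.e. p(x) ≥ 0 for all x ∈ ℝ and ∫_ℝ p(x) dx = 1. -/
open MeasureTheory Real Filter

lemma vg_gauss (β b : ℝ) (hb : 0 < b) :
    Integrable (fun y : ℝ => Real.exp (β * y - b * y ^ 2)) ∧
    ∫ y : ℝ, Real.exp (β * y - b * y ^ 2) = Real.exp (β ^ 2 / (4 * b)) * Real.sqrt (π / b) := by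
  have h : (fun y : ℝ => Real.exp (β * y - b * y ^ 2)) =
      fun y => Real.exp (β ^ 2 / (4 * b)) * Real.exp (-b * (y - β / (2 * b)) ^ 2) := by
    funext y
    rw [← Real.exp_add]
    congr 1
    field_simp
    ring
  rw [h]
  constructor
  · exact ((integrable_exp_neg_mul_sq hb).comp_sub_right (β / (2 * b))).const_mul _
  · rw [integral_const_mul,
      integral_sub_right_eq_self (fun y : ℝ => Real.exp (-b * y ^ 2)) (β / (2 * b)),
      integral_gaussian]

lemma vg_gamma (a δ : ℝ) (ha : 0 < a) (hδ : 0 < δ) :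
    Integrable (fun s : ℝ => Real.exp (a * s - δ * Real.exp s)) ∧
    ∫ s : ℝ, Real.exp (a * s - δ * Real.exp s) = (1 / δ) ^ a * Real.Gamma a := by
  have h : (fun s : ℝ => Real.exp (a * s - δ * Real.exp s)) =
      fun s => |Real.exp s| • ((Real.exp s) ^ (a - 1) * Real.exp (-(δ * Real.exp s))) := by
    funext s
    rw [abs_of_pos (Real.exp_pos s), ← Real.exp_mul, smul_eq_mul, ← Real.exp_add, ← Real.exp_add]
    congr 1
    ring
  have him : Set.image Real.exp Set.univ = Set.Ioi 0 := by rw [Set.image_univ, Real.range_exp]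
  have hd : ∀ x ∈ Set.univ, HasDerivWithinAt Real.exp (Real.exp x) Set.univ x :=
    fun x _ => (Real.hasDerivAt_exp x).hasDerivWithinAt
  have hint : IntegrableOn (fun t : ℝ => t ^ (a - 1) * Real.exp (-(δ * t))) (Set.Ioi 0) := by
    have := integrableOn_rpow_mul_exp_neg_mul_rpow (s := a - 1) (p := 1) (b := δ)
      (by linarith) one_pos hδ
    simpa using this
  have hval := Real.integral_rpow_mul_exp_neg_mul_Ioi ha hδ
  rw [h]
  constructor
  · rw [← integrableOn_univ]
    rw [← integrableOn_image_iff_integrableOn_abs_deriv_smul MeasurableSet.univ hd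
      Real.exp_injective.injOn (fun t : ℝ => t ^ (a - 1) * Real.exp (-(δ * t))), him]
    exact hint
  · rw [← hval, ← him, integral_image_eq_integral_abs_deriv_smul MeasurableSet.univ hd
      Real.exp_injective.injOn (fun t : ℝ => t ^ (a - 1) * Real.exp (-(δ * t)))]
    rw [setIntegral_univ]

/-- The joint kernel of the normal mixture representation. -/
noncomputable def vgF (ν α β y s : ℝ) : ℝ :=
  Real.exp (ν * s - α ^ 2 * Real.exp s / 2 + (β * y - Real.exp (-s) / 2 * y ^ 2))

lemma vgF_inner (ν α β s : ℝ) :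
    Integrable (fun y => vgF ν α β y s) ∧
    ∫ y, vgF ν α β y s = Real.sqrt (2 * π) *
      Real.exp ((ν + 1 / 2) * s - (α ^ 2 - β ^ 2) / 2 * Real.exp s) := by
  have hb : 0 < Real.exp (-s) / 2 := by positivity
  obtain ⟨h1, h2⟩ := vg_gauss β _ hb
  have h : (fun y => vgF ν α β y s) = fun y => Real.exp (ν * s - α ^ 2 * Real.exp s / 2) *
      Real.exp (β * y - Real.exp (-s) / 2 * y ^ 2) := by
    funext y; rw [vgF, Real.exp_add]
  rw [h]
  refine ⟨h1.const_mul _, ?_⟩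
  rw [integral_const_mul, h2]
  have e1 : π / (Real.exp (-s) / 2) = (2 * π) * Real.exp s := by
    rw [Real.exp_neg]; field_simp
  have e2 : β ^ 2 / (4 * (Real.exp (-s) / 2)) = β ^ 2 * Real.exp s / 2 := by
    rw [Real.exp_neg]; field_simp; ring
  have e3 : Real.sqrt (Real.exp s) = Real.exp (s / 2) := by
    rw [Real.exp_half]
  rw [e1, e2, Real.sqrt_mul (by positivity), e3]
  have : Real.exp ((ν + 1 / 2) * s - (α ^ 2 - β ^ 2) / 2 * Real.exp s) =
      Real.exp (ν * s - α ^ 2 * Real.exp s / 2) * Real.exp (β ^ 2 * Real.exp s / 2) *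
        Real.exp (s / 2) := by
    rw [← Real.exp_add, ← Real.exp_add]; congr 1; ring
  rw [this]; ring

lemma vgF_integrable (ν α β : ℝ) (hν : ν > -1/2) (hβ : |β| < α) :
    Integrable (Function.uncurry (vgF ν α β)) (volume.prod volume) := by
  have hδ : 0 < (α ^ 2 - β ^ 2) / 2 := by
    have := sq_lt_sq' (by linarith [neg_abs_le β, abs_nonneg β]) hβ
    rw [sq_abs] at this; linarith
  rw [integrable_prod_iff']
  · refine ⟨Eventually.of_forall fun s => (vgF_inner ν α β s).1, ?_⟩
    have : (fun s => ∫ y, ‖Function.uncurry (vgF ν α β) (y, s)‖) = fun s =>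
        Real.sqrt (2 * π) *
      Real.exp ((ν + 1 / 2) * s - (α ^ 2 - β ^ 2) / 2 * Real.exp s) := by
      funext s
      rw [← (vgF_inner ν α β s).2]
      congr 1; funext y
      simp [Function.uncurry, vgF]
    rw [this]
    exact (vg_gamma _ _ (by linarith) hδ).1.const_mul _
  · apply Continuous.aestronglyMeasurable
    unfold vgF Function.uncurry
    fun_prop

lemma besselK_eq_s4 (ν x : ℝ)
    (hi : Integrable (fun t : ℝ => Real.exp (-x * Real.cosh t + ν * t))) :
    besselK ν x = 1 / 2 * ∫ t : ℝ, Real.exp (-x * Real.cosh t + ν * t) := by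
  have h := integral_comp_abs (f := fun t => Real.exp (-x * Real.cosh t) * Real.cosh (ν * t))
  have h2 : (fun t : ℝ => Real.exp (-x * Real.cosh |t|) * Real.cosh (ν * |t|)) =
      fun t => 1 / 2 * Real.exp (-x * Real.cosh t + ν * t) +
        1 / 2 * Real.exp (-x * Real.cosh (-t) + ν * (-t)) := by
    funext t
    have : Real.cosh (ν * |t|) = Real.cosh (ν * t) := by
      rw [← Real.cosh_abs, ← Real.cosh_abs (ν * t), abs_mul, abs_mul, abs_abs]
    rw [this, Real.cosh_abs, Real.cosh_neg, Real.exp_add, Real.exp_add, Real.cosh_eq (ν * t),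
      mul_neg]
    ring
  rw [h2, integral_add (hi.const_mul _) (hi.comp_neg.const_mul _), integral_const_mul,
    integral_const_mul, integral_neg_eq_self (fun t => Real.exp (-x * Real.cosh t + ν * t))] at h
  unfold besselK
  linarith

lemma vg_pointwise (ν α β y : ℝ) (hα : 0 < α) (hy : y ≠ 0)
    (hi : Integrable (fun s => vgF ν α β y s)) :
    Real.exp (β * y) * |y| ^ ν * besselK ν (α * |y|) = α ^ ν / 2 * ∫ s, vgF ν α β y s := by
  have hy' : 0 < |y| := abs_pos.mpr hy
  have key : ∀ t : ℝ, Real.exp (-(α * |y|) * Real.cosh t + ν * t) =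
      (Real.exp (-(β * y)) * (α / |y|) ^ ν) * vgF ν α β y (t - Real.log (α / |y|)) := by
    intro t
    have e1 : Real.exp (t - Real.log (α / |y|)) = Real.exp t * |y| / α := by
      rw [Real.exp_sub, Real.exp_log (by positivity)]; field_simp
    have e2 : Real.exp (-(t - Real.log (α / |y|))) = Real.exp (-t) * α / |y| := by
      rw [neg_sub, sub_eq_add_neg, Real.exp_add, Real.exp_log (by positivity)]; field_simp
    rw [vgF, e1, e2, Real.rpow_def_of_pos (by positivity), ← Real.exp_add, ← Real.exp_add]
    congr 1
    rw [Real.cosh_eq, ← sq_abs y]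
    field_simp
    ring
  have key' := funext key
  have hi2 : Integrable (fun t : ℝ => Real.exp (-(α * |y|) * Real.cosh t + ν * t)) := by
    rw [key']
    exact (hi.comp_sub_right _).const_mul _
  rw [besselK_eq_s4 _ _ hi2, key', integral_const_mul,
    integral_sub_right_eq_self (fun s => vgF ν α β y s), Real.div_rpow hα.le hy'.le,
    Real.exp_neg]
  have := (Real.rpow_pos_of_pos hy' ν).ne'
  have := (Real.exp_pos (β * y)).ne'
  field_simp

theorem vg_is_density (ν α β : ℝ) (hν : ν > -1/2) (hβ : |β| < α) :
    (∀ x : ℝ, 0 ≤ vgDensity ν α β x) ∧ ∫ x : ℝ, vgDensity ν α β x = 1 := by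
  have hα : 0 < α := lt_of_le_of_lt (abs_nonneg β) hβ
  have hD : 0 < α ^ 2 - β ^ 2 := by
    have := sq_lt_sq' (by linarith [neg_abs_le β, abs_nonneg β]) hβ
    rw [sq_abs] at this; linarith
  have ha : 0 < ν + 1 / 2 := by linarith
  have hG := Real.Gamma_pos_of_pos ha
  constructor
  · intro x
    have hK : 0 ≤ besselK ν (α * |x|) :=
      integral_nonneg fun t => mul_nonneg (Real.exp_pos _).le (Real.cosh_pos _).le
    unfold vgDensity
    positivity
  · have hint := vgF_integrable ν α β hν hβ
    have hae : (fun x => vgDensity ν α β x) =ᵐ[volume] fun x =>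
        (α ^ 2 - β ^ 2) ^ (ν + 1/2) / (Real.sqrt π * (2 * α) ^ ν * Real.Gamma (ν + 1/2)) *
          (α ^ ν / 2 * ∫ s, vgF ν α β x s) := by
      have h0 : ∀ᵐ x : ℝ, x ≠ 0 := by simp [ae_iff]
      filter_upwards [hint.prod_right_ae, h0] with x hx hx0
      rw [vgDensity, vg_pointwise ν α β x hα hx0 hx]
    rw [integral_congr_ae hae, integral_const_mul, integral_const_mul,
      integral_integral_swap hint]
    simp_rw [(vgF_inner ν α β _).2]
    rw [integral_const_mul, (vg_gamma (ν + 1/2) _ ha (half_pos hD)).2]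
    rw [one_div_div, Real.div_rpow (by norm_num) hD.le, Real.mul_rpow (by norm_num) hα.le,
      Real.rpow_add (by norm_num : (0:ℝ) < 2), ← Real.sqrt_eq_rpow, Real.sqrt_mul (by norm_num)]
    have h1 := (Real.rpow_pos_of_pos hD (ν + 1/2)).ne'
    have h2 := (Real.rpow_pos_of_pos hα ν).ne'
    have h3 := (Real.rpow_pos_of_pos (by norm_num : (0:ℝ) < 2) ν).ne'
    have h4 := (Real.sqrt_pos.mpr Real.pi_pos).ne'
    have h5 : Real.sqrt 2 * Real.sqrt 2 = 2 := Real.mul_self_sqrt (by norm_num)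
    generalize (α ^ 2 - β ^ 2) ^ (ν + 1/2) = A at *
    generalize Real.Gamma (ν + 1/2) = G at *
    generalize α ^ ν = B at *
    generalize (2:ℝ) ^ ν = C at *
    generalize Real.sqrt π = P at *
    generalize Real.sqrt 2 = S at *
    have hG' := hG.ne'
    field_simp
    linarith
end

section
/- Let ν > -1/2 and 0 ≤ |β| < α, and let p be the variance-gamma density with parameters (ν, α, β, 0). Then for every real k > k_* = max{-1, -2ν-1}, the function x ↦ |x|^k p(x) is integrable on ℝ, i.e. ∫_ℝ |x|^k p(x) dx < ∞. -/
open MeasureTheory Real Filter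

theorem vg_aux_integral {s r : ℝ} (hs : 0 < s) (hr : 0 < r) :
    ∫ x : ℝ, |x| ^ (s - 1) * Real.exp (-(r * |x|)) = 2 * ((1 / r) ^ s * Real.Gamma s) := by
  rw [← Real.integral_rpow_mul_exp_neg_mul_Ioi hs hr]
  exact integral_comp_abs (f := fun x => x ^ (s - 1) * Real.exp (-(r * x)))

theorem vg_aux_integrable {s r : ℝ} (hs : 0 < s) (hr : 0 < r) :
    Integrable (fun x : ℝ => |x| ^ (s - 1) * Real.exp (-(r * |x|))) := by
  refine Integrable.of_integral_ne_zero ?_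
  rw [vg_aux_integral hs hr]
  have := Real.Gamma_pos_of_pos hs
  positivity

theorem vg_aux_cosh (ν : ℝ) {t : ℝ} (ht : 0 < t) :
    Real.cosh (ν * t) ≤ Real.exp (|ν| * t) := by
  rw [Real.cosh_eq]
  have h1 : Real.exp (ν * t) ≤ Real.exp (|ν| * t) :=
    Real.exp_le_exp.2 (mul_le_mul_of_nonneg_right (le_abs_self _) ht.le)
  have h2 : Real.exp (-(ν * t)) ≤ Real.exp (|ν| * t) := by
    rw [← neg_mul]
    exact Real.exp_le_exp.2 (mul_le_mul_of_nonneg_right (neg_le_abs _) ht.le)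
  linarith

theorem vg_aux_bound {c s t : ℝ} (hc : 0 < c) (hs : 0 < s) :
    (1 / (c * Real.cosh t)) ^ s ≤ (2 / c) ^ s * Real.exp (-(s * t)) := by
  have h0 : Real.exp t / 2 ≤ Real.cosh t := by
    rw [Real.cosh_eq]
    linarith [Real.exp_pos (-t)]
  have h1 : 1 / (c * Real.cosh t) ≤ (2 / c) * Real.exp (-t) := by
    have e : (2 / c) * Real.exp (-t) = 1 / (c * (Real.exp t / 2)) := by
      rw [Real.exp_neg]
      field_simp
    rw [e]
    have := Real.exp_pos t
    apply one_div_le_one_div_of_le (by positivity)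
    exact mul_le_mul_of_nonneg_left h0 hc.le
  have hp := Real.cosh_pos t
  calc (1 / (c * Real.cosh t)) ^ s ≤ ((2 / c) * Real.exp (-t)) ^ s :=
        Real.rpow_le_rpow (by positivity) h1 hs.le
    _ = _ := by
        rw [Real.mul_rpow (by positivity) (Real.exp_pos _).le, ← Real.exp_mul]
        ring_nf

theorem vg_aux_prod {c s ν : ℝ} (hc : 0 < c) (hs : |ν| < s) :
    Integrable (fun p : ℝ × ℝ =>
      |p.1| ^ (s - 1) * Real.exp (-((c * Real.cosh p.2) * |p.1|)) * Real.cosh (ν * p.2))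
      (volume.prod (volume.restrict (Set.Ioi (0 : ℝ)))) := by
  have hs0 : 0 < s := lt_of_le_of_lt (abs_nonneg _) hs
  have hr : ∀ t, 0 < c * Real.cosh t := fun t => mul_pos hc (Real.cosh_pos t)
  rw [integrable_prod_iff' (Measurable.aestronglyMeasurable (by fun_prop))]
  refine ⟨ae_of_all _ fun t => (vg_aux_integrable hs0 (hr t)).mul_const (Real.cosh (ν * t)), ?_⟩
  have e : (fun t : ℝ => ∫ x : ℝ, ‖|x| ^ (s - 1) * Real.exp (-((c * Real.cosh t) * |x|)) *
      Real.cosh (ν * t)‖) =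
      fun t => 2 * ((1 / (c * Real.cosh t)) ^ s * Real.Gamma s) * Real.cosh (ν * t) := by
    funext t
    rw [← vg_aux_integral hs0 (hr t), ← integral_mul_const]
    congr 1
    funext x
    rw [Real.norm_of_nonneg]
    have := Real.cosh_pos (ν * t)
    positivity
  simp only [e]
  have hG := Real.Gamma_pos_of_pos hs0
  refine Integrable.mono'
    (g := fun t => 2 * (2 / c) ^ s * Real.Gamma s * Real.exp (-(s - |ν|) * t))
    ((exp_neg_integrableOn_Ioi 0 (sub_pos.2 hs)).const_mul _)
    (Measurable.aestronglyMeasurable (by fun_prop)) ?_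
  filter_upwards [ae_restrict_mem measurableSet_Ioi] with t ht
  have hp := Real.cosh_pos (ν * t)
  have hq := hr t
  rw [Real.norm_of_nonneg (by positivity)]
  calc 2 * ((1 / (c * Real.cosh t)) ^ s * Real.Gamma s) * Real.cosh (ν * t)
      ≤ 2 * (((2 / c) ^ s * Real.exp (-(s * t))) * Real.Gamma s) * Real.exp (|ν| * t) := by
        gcongr
        · exact vg_aux_bound hc hs0
        · exact vg_aux_cosh ν ht
    _ = _ := by
        rw [show -(s - |ν|) * t = -(s * t) + |ν| * t by ring, Real.exp_add]
        ring

theorem vg_aux_prod2 {α β s ν : ℝ} (hβ : |β| < α) (hs : |ν| < s) :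
    Integrable (fun p : ℝ × ℝ =>
      |p.1| ^ (s - 1) * Real.exp (β * p.1) *
        (Real.exp (-(α * |p.1|) * Real.cosh p.2) * Real.cosh (ν * p.2)))
      (volume.prod (volume.restrict (Set.Ioi (0 : ℝ)))) := by
  refine (vg_aux_prod (sub_pos.2 hβ) hs).mono' (Measurable.aestronglyMeasurable (by fun_prop))
    (ae_of_all _ ?_)
  rintro ⟨x, t⟩
  have hp := Real.cosh_pos (ν * t)
  have h1 := Real.one_le_cosh t
  have hb : β * x ≤ |β| * |x| := by
    rw [← abs_mul]
    exact le_abs_self _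
  have hb2 : 0 ≤ |β| * |x| := by positivity
  have key : Real.exp (β * x) * Real.exp (-(α * |x|) * Real.cosh t) ≤
      Real.exp (-(((α - |β|) * Real.cosh t) * |x|)) := by
    rw [← Real.exp_add]
    apply Real.exp_le_exp.2
    nlinarith
  dsimp only
  rw [Real.norm_of_nonneg (by positivity)]
  calc _ = |x| ^ (s - 1) * (Real.exp (β * x) * Real.exp (-(α * |x|) * Real.cosh t)) *
        Real.cosh (ν * t) := by ring
    _ ≤ _ := by gcongr

theorem vg_abs_moment_integrable (ν α β : ℝ) (hν : ν > -1/2) (hβ : |β| < α)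
    (k : ℝ) (hk : k > max (-1) (-2*ν - 1)) :
    MeasureTheory.Integrable (fun x : ℝ => |x| ^ k * vgDensity ν α β x) := by
  have hs : |ν| < k + ν + 1 := by
    have h1 := (max_lt_iff.1 hk).1
    have h2 := (max_lt_iff.1 hk).2
    rw [abs_lt]
    constructor <;> linarith
  have h := ((vg_aux_prod2 hβ hs).integral_prod_left).const_mul
    ((α ^ 2 - β ^ 2) ^ (ν + 1/2) / (Real.sqrt π * (2 * α) ^ ν * Real.Gamma (ν + 1/2)))
  refine h.congr ?_
  filter_upwards [Measure.ae_ne volume (0 : ℝ)] with x hx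
  have hx' : 0 < |x| := abs_pos.2 hx
  rw [integral_const_mul, show k + ν + 1 - 1 = k + ν by ring, Real.rpow_add hx']
  unfold vgDensity besselK
  ring
end

section
/- Let ν > -1/2 and 0 ≤ |β| < α, and let p be the variance-gamma density with parameters (ν, α, β, 0). Then for every odd positive integer k, ∫_ℝ x^k p(x) dx = 2M · Σ_{j=0}^∞ (β^{2j+1} / (2j+1)!) · ∫_0^∞ t^{ν+k+2j+1} K_ν(α t) dt, where M = (α² - β²)^{ν+1/2} / (√π (2α)^ν Γ(ν + 1/2)). -/
open MeasureTheory Real Filter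

lemma exp_neg_le_rpow (a : ℝ) (ha : 0 < a) (y : ℝ) (hy : 0 < y) :
    Real.exp (-y) ≤ a ^ a * y ^ (-a) := by
  have h1 : y / a ≤ Real.exp (y / a) := by
    have := Real.add_one_le_exp (y / a); linarith
  have h2 : (y / a) ^ a ≤ Real.exp (y / a) ^ a :=
    Real.rpow_le_rpow (by positivity) h1 ha.le
  rw [← Real.exp_mul, div_mul_cancel₀ _ ha.ne', Real.div_rpow hy.le ha.le] at h2
  have hp : 0 < a ^ a := Real.rpow_pos_of_pos ha a
  have hq : 0 < y ^ a := Real.rpow_pos_of_pos hy a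
  rw [Real.exp_neg, Real.rpow_neg hy.le, ← div_eq_mul_inv, inv_eq_one_div,
    div_le_div_iff₀ (Real.exp_pos y) hq]
  rw [div_le_iff₀ hp] at h2
  linarith

lemma besselK_bound (ν c : ℝ) (hc0 : 0 ≤ c) (hc : c < 1) :
    ∃ C : ℝ, ∀ x : ℝ, 0 < x →
      besselK ν x ≤ C * x ^ (-(|ν| + 1)) * Real.exp (-(c * x)) := by
  set a := |ν| + 1 with ha
  have ha0 : 0 < a := by positivity
  refine ⟨a ^ a * ((1 - c) / 2) ^ (-a), fun x hx => ?_⟩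
  have hI : IntegrableOn (fun t : ℝ => Real.exp (-t)) (Set.Ioi 0) := integrableOn_exp_neg_Ioi 0
  have hval : ∫ t in Set.Ioi (0:ℝ), Real.exp (-t) = 1 := integral_exp_neg_Ioi_zero
  calc besselK ν x ≤ ∫ t in Set.Ioi (0:ℝ),
        (a ^ a * ((1 - c) / 2) ^ (-a) * x ^ (-a) * Real.exp (-(c * x))) * Real.exp (-t) := by
        unfold besselK
        refine integral_mono_of_nonneg ?_ (hI.const_mul _) ?_
        · refine Eventually.of_forall fun t => ?_
          have := Real.cosh_pos (ν * t)
          simp only [Pi.zero_apply]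
          positivity
        · refine (ae_restrict_iff' measurableSet_Ioi).2 (Eventually.of_forall fun t ht => ?_)
          have ht : 0 < t := ht
          have hd : 0 < 1 - c := by linarith
          have hch1 : 1 ≤ Real.cosh t := Real.one_le_cosh t
          have hch2 : Real.exp t / 2 ≤ Real.cosh t := by
            rw [Real.cosh_eq]; have := Real.exp_pos (-t); linarith
          have hy : 0 < (1 - c) / 2 * x * Real.exp t := by positivity
          have e1 : Real.exp (-x * Real.cosh t) ≤
              Real.exp (-(c * x)) * Real.exp (-((1 - c) / 2 * x * Real.exp t)) := by
            rw [← Real.exp_add]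
            apply Real.exp_le_exp.2
            have i1 := mul_le_mul_of_nonneg_left hch1 (mul_nonneg hc0 hx.le)
            have i2 := mul_le_mul_of_nonneg_left hch2 (mul_nonneg hd.le hx.le)
            nlinarith
          have e2 := exp_neg_le_rpow a ha0 _ hy
          have e3 : ((1 - c) / 2 * x * Real.exp t) ^ (-a) =
              ((1 - c) / 2) ^ (-a) * x ^ (-a) * Real.exp (-(a * t)) := by
            rw [Real.mul_rpow (by positivity) (Real.exp_pos t).le,
              Real.mul_rpow (by positivity) hx.le, ← Real.exp_mul]
            congr 2; ring
          have e4 : Real.cosh (ν * t) ≤ Real.exp (|ν| * t) := by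
            rw [← Real.cosh_abs, abs_mul, abs_of_pos ht, Real.cosh_eq]
            have : Real.exp (-(|ν| * t)) ≤ Real.exp (|ν| * t) :=
              Real.exp_le_exp.2 (by have : 0 ≤ |ν| * t := by positivity
                                    linarith)
            linarith
          have e5 : Real.exp (-t) = Real.exp (-(a * t)) * Real.exp (|ν| * t) := by
            rw [← Real.exp_add]; congr 1; rw [ha]; ring
          rw [e3] at e2
          have hcp := Real.cosh_pos (ν * t)
          calc Real.exp (-x * Real.cosh t) * Real.cosh (ν * t)
              ≤ (Real.exp (-(c * x)) * (a ^ a * (((1 - c) / 2) ^ (-a) * x ^ (-a) *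
                  Real.exp (-(a * t))))) * Real.exp (|ν| * t) := by
                refine mul_le_mul (e1.trans ?_) e4 hcp.le (by positivity)
                exact mul_le_mul_of_nonneg_left e2 (Real.exp_pos _).le
            _ = _ := by beta_reduce; rw [e5]; ring
    _ = _ := by rw [integral_const_mul, hval, mul_one]

lemma besselK_measurable (ν : ℝ) : Measurable (besselK ν) := by
  have h : StronglyMeasurable (Function.uncurry fun x t : ℝ =>
      Real.exp (-x * Real.cosh t) * Real.cosh (ν * t)) := by
    apply Continuous.stronglyMeasurable
    simp only [Function.uncurry_def]
    have := Real.continuous_cosh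
    fun_prop
  exact (h.integral_prod_right (ν := volume.restrict (Set.Ioi (0:ℝ)))).measurable

lemma vg_integrable (ν α b : ℝ) (hν : ν > -1/2) (hb : |b| < α) (k : ℕ) (hk0 : 0 < k) :
    IntegrableOn (fun t : ℝ => t ^ k * (Real.exp (b * t) * t ^ ν * besselK ν (α * t)))
      (Set.Ioi 0) := by
  have hα : 0 < α := (abs_nonneg b).trans_lt hb
  obtain ⟨hb1, hb2⟩ := abs_lt.1 hb
  obtain ⟨C, hC⟩ := besselK_bound ν ((α + b) / (2 * α))
    (div_nonneg (by linarith) (by linarith)) ((div_lt_one (by linarith)).2 (by linarith))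
  have hs : -1 < (k:ℝ) + ν - (|ν| + 1) := by
    have : (1:ℝ) ≤ k := by exact_mod_cast hk0
    rcases abs_cases ν with h | h <;> linarith [h.1]
  have hI := integrableOn_rpow_mul_exp_neg_mul_rpow (p := 1) (b := (α - b) / 2) hs one_pos
    (by linarith)
  have hI2 := hI.const_mul (C * α ^ (-(|ν| + 1)))
  refine Integrable.mono' hI2 ?_ ?_
  · have := besselK_measurable ν
    apply Measurable.aestronglyMeasurable
    fun_prop
  · refine (ae_restrict_iff' measurableSet_Ioi).2 (Eventually.of_forall fun t ht => ?_)
    have ht : 0 < t := ht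
    have hK := besselK_nonneg ν (α * t)
    have hB := hC (α * t) (by positivity)
    rw [Real.norm_of_nonneg (by positivity)]
    calc t ^ k * (Real.exp (b * t) * t ^ ν * besselK ν (α * t))
        ≤ t ^ k * (Real.exp (b * t) * t ^ ν * (C * (α * t) ^ (-(|ν| + 1)) *
          Real.exp (-((α + b) / (2 * α) * (α * t))))) := by gcongr
      _ = _ := by
        have e1 : (α * t) ^ (-(|ν| + 1)) = α ^ (-(|ν| + 1)) * t ^ (-(|ν| + 1)) :=
          Real.mul_rpow hα.le ht.le
        have e2 : Real.exp (-((α - b) / 2) * t ^ (1:ℝ)) =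
            Real.exp (b * t) * Real.exp (-((α + b) / (2 * α) * (α * t))) := by
          rw [← Real.exp_add, Real.rpow_one]; congr 1; field_simp; ring
        have e3 : t ^ ((k:ℝ) + ν - (|ν| + 1)) = t ^ k * t ^ ν * t ^ (-(|ν| + 1)) := by
          rw [sub_eq_add_neg, Real.rpow_add ht, Real.rpow_add ht, Real.rpow_natCast]
        rw [e1, e2, e3]; ring

lemma integrableOn_Iic_of_neg (f : ℝ → ℝ) (h : IntegrableOn (fun t => f (-t)) (Set.Ioi 0)) :
    IntegrableOn f (Set.Iic 0) := by
  rw [integrableOn_Iic_iff_integrableOn_Iio]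
  have h' : IntegrableOn (fun t => f (-t)) (Set.Ioi (-0)) := by rwa [neg_zero]
  have h2 := h'.comp_neg_Iio
  simpa only [neg_neg] using h2

theorem vg_odd_moment_series (ν α β : ℝ) (hν : ν > -1/2) (hβ : |β| < α)
    (k : ℕ) (hk : Odd k) (hk0 : 0 < k) :
    ∫ x : ℝ, x ^ k * vgDensity ν α β x =
      2 * ((α ^ 2 - β ^ 2) ^ (ν + 1/2) / (Real.sqrt π * (2 * α) ^ ν * Real.Gamma (ν + 1/2))) *
        ∑' j : ℕ, β ^ (2 * j + 1) / (Nat.factorial (2 * j + 1)) *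
          ∫ t in Set.Ioi (0 : ℝ), t ^ (ν + (k : ℝ) + 2 * (j : ℝ) + 1) * besselK ν (α * t) := by
  unfold vgDensity
  set M := (α ^ 2 - β ^ 2) ^ (ν + 1/2) / (Real.sqrt π * (2 * α) ^ ν * Real.Gamma (ν + 1/2))
  have hI1 := vg_integrable ν α β hν hβ k hk0
  have hI2 := vg_integrable ν α (-β) hν (by rwa [abs_neg]) k hk0
  have hA1 := vg_integrable ν α |β| hν (by rwa [abs_abs]) k hk0
  have hA2 := vg_integrable ν α (-|β|) hν (by rwa [abs_neg, abs_abs]) k hk0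
  set f : ℝ → ℝ := fun x => x ^ k * (Real.exp (β * x) * |x| ^ ν * besselK ν (α * |x|)) with hf
  have hfp : Set.EqOn (fun t : ℝ => t ^ k * (Real.exp (β * t) * t ^ ν * besselK ν (α * t))) f
      (Set.Ioi 0) := by
    intro t ht
    have ht : 0 < t := ht
    simp only [hf, abs_of_pos ht]
  have hfn : Set.EqOn (fun t : ℝ => -(t ^ k * (Real.exp (-β * t) * t ^ ν * besselK ν (α * t))))
      (fun t => f (-t)) (Set.Ioi 0) := by
    intro t ht
    have ht : 0 < t := ht
    simp only [hf, abs_neg, abs_of_pos ht, hk.neg_pow, neg_mul, mul_neg]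
  have hfI : IntegrableOn f (Set.Ioi 0) := hI1.congr_fun hfp measurableSet_Ioi
  have hfN : IntegrableOn (fun t => f (-t)) (Set.Ioi 0) :=
    IntegrableOn.congr_fun hI2.neg hfn measurableSet_Ioi
  have hfIic : IntegrableOn f (Set.Iic 0) := integrableOn_Iic_of_neg f hfN
  have hsplit : ∫ x, f x = ∫ t in Set.Ioi (0:ℝ), 2 * (t ^ k * (Real.sinh (β * t) * t ^ ν *
      besselK ν (α * t))) := by
    rw [← intervalIntegral.integral_Iic_add_Ioi hfIic hfI]
    have h0 := integral_comp_neg_Ioi (0:ℝ) f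
    rw [neg_zero] at h0
    rw [← h0, ← integral_add hfN hfI]
    refine setIntegral_congr_fun measurableSet_Ioi fun t ht => ?_
    rw [← hfp ht]
    have := hfn ht
    simp only at this
    rw [← this, Real.sinh_eq, neg_mul]
    ring
  have hsum := hasSum_integral_of_dominated_convergence (μ := volume.restrict (Set.Ioi (0:ℝ)))
    (F := fun (j : ℕ) (t : ℝ) => t ^ k * ((β * t) ^ (2 * j + 1) / (Nat.factorial (2 * j + 1)) * t ^ ν *
      besselK ν (α * t)))
    (f := fun t => t ^ k * (Real.sinh (β * t) * t ^ ν * besselK ν (α * t)))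
    (fun (j : ℕ) (t : ℝ) => t ^ k * ((|β| * t) ^ (2 * j + 1) / (Nat.factorial (2 * j + 1)) * t ^ ν *
      besselK ν (α * t)))
    (by
      intro j
      have := besselK_measurable ν
      apply Measurable.aestronglyMeasurable
      fun_prop)
    (by
      intro j
      refine (ae_restrict_iff' measurableSet_Ioi).2 (Eventually.of_forall fun t ht => ?_)
      have ht : 0 < t := ht
      have hK := besselK_nonneg ν (α * t)
      have hp := Real.rpow_pos_of_pos ht ν
      simp only [norm_mul, norm_div, norm_pow, Real.norm_eq_abs, abs_of_pos ht, abs_of_pos hp,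
        abs_of_nonneg hK, Nat.abs_cast, le_refl])
    (by
      refine Eventually.of_forall fun t => ?_
      exact (((Real.hasSum_sinh (|β| * t)).mul_right _).mul_right _).summable.mul_left _)
    (by
      have h : IntegrableOn (fun t : ℝ => t ^ k * (Real.sinh (|β| * t) * t ^ ν *
          besselK ν (α * t))) (Set.Ioi 0) := by
        refine ((hA1.sub hA2).const_mul (1/2)).congr (Eventually.of_forall fun t => ?_)
        simp only [Pi.sub_apply, Real.sinh_eq, neg_mul]
        ring
      refine h.congr (Eventually.of_forall fun t => ?_)
      exact ((((Real.hasSum_sinh (|β| * t)).mul_right _).mul_right _).mul_left _).tsum_eq.symm)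
    (by
      refine Eventually.of_forall fun t => ?_
      exact (((Real.hasSum_sinh (β * t)).mul_right _).mul_right _).mul_left _)
  have hL : ∫ x : ℝ, x ^ k * (M * (Real.exp (β * x) * |x| ^ ν * besselK ν (α * |x|))) =
      M * ∫ x, f x := by
    rw [← integral_const_mul]
    refine integral_congr_ae (Eventually.of_forall fun x => ?_)
    simp only [hf]; ring
  rw [hL, hsplit, integral_const_mul, ← hsum.tsum_eq, ← mul_assoc, mul_comm M 2]
  congr 1
  refine tsum_congr fun j => ?_
  rw [← integral_const_mul]
  refine setIntegral_congr_fun measurableSet_Ioi fun t ht => ?_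
  have ht : 0 < t := ht
  have e : t ^ (ν + (k : ℝ) + 2 * (j : ℝ) + 1) = t ^ ν * t ^ k * t ^ (2 * j + 1) := by
    rw [← Real.rpow_natCast t k, ← Real.rpow_natCast t (2 * j + 1), ← Real.rpow_add ht,
      ← Real.rpow_add ht]
    congr 1; push_cast; ring
  simp only [e, mul_pow]
  ring
end
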